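/- For any canonical module ω_R of R one has H^i_I(ω_R) = 0 for all i ∉ {n−1, m+n−2}, while H^{n−1}_I(ω_R) ≠ 0 and H^{m+n−2}_I(ω_R) ≠ 0; in particular the cohomological dimension of I equals m+n−2. -/

import Mathlib

open CategoryTheory Opposite MvPowerSeries

set_option synthInstance.maxHeartbeats 1000000
set_option maxHeartbeats 1000000

noncomputable section

/-- The grade of an ideal: the maximal length of a regular sequence contained in it. -/
def idealGrade {A : Type} [CommRing A] (J : Ideal A) : ℕ∞ :=
  sSup {c : ℕ∞ | ∃ rs : List A, (∀ r ∈ rs, r ∈ J) ∧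
    RingTheory.Sequence.IsRegular A rs ∧ (rs.length : ℕ∞) = c}

/-- The height of an ideal: the infimum of heights of primes containing it. -/
def idealHeight {A : Type} [CommRing A] (J : Ideal A) : ℕ∞ :=
  sInf {h : ℕ∞ | ∃ p : PrimeSpectrum A, J ≤ p.asIdeal ∧ Order.height p = h}

/-- A canonical module of a `d`-dimensional local ring `A`: a finitely generated module `ω`
with `Ext_A^i(𝕜, ω) = 0` for `i ≠ d` and `Ext_A^d(𝕜, ω)` a one-dimensional `𝕜`-vector space
(equivalently, isomorphic to `𝕜` as an `A`-module), where `𝕜` is the residue field. -/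
def IsCanonicalModule (A : Type) [CommRing A] [IsLocalRing A] (d : ℕ)
    (ω : ModuleCat A) : Prop :=
  Module.Finite A ω ∧
  (∀ i : ℕ, i ≠ d → Subsingleton
    (((Ext A (ModuleCat A) i).obj
      (op (ModuleCat.of A (IsLocalRing.ResidueField A)))).obj ω)) ∧
  Nonempty ((((Ext A (ModuleCat A) d).obj
      (op (ModuleCat.of A (IsLocalRing.ResidueField A)))).obj ω)
    ≃ₗ[A] IsLocalRing.ResidueField A)

variable (𝕜 : Type) [Field 𝕜] (m n : ℕ)

/-- The formal power series ring `P` in the entries of an `m × n` matrix of variables. -/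
abbrev DetP := MvPowerSeries (Fin m × Fin n) 𝕜

/-- The ideal of `P` generated by the `2 × 2` minors of the matrix of variables. -/
def detI2 : Ideal (DetP 𝕜 m n) :=
  Ideal.span {f | ∃ (i k : Fin m) (j l : Fin n), i < k ∧ j < l ∧
    f = X (i, j) * X (k, l) - X (i, l) * X (k, j)}

/-- The complete determinantal ring `R = P/I₂(X)`. -/
abbrev DetR := DetP 𝕜 m n ⧸ detI2 𝕜 m n

/-- The residue class in `R` of the variable `x_{ij}`. -/
def detx (i : Fin m) (j : Fin n) : DetR 𝕜 m n :=
  Ideal.Quotient.mk (detI2 𝕜 m n) (X (i, j))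

/-- The ideal `I` of `R` generated by the entries of the first `n - 1` columns. -/
def detJ : Ideal (DetR 𝕜 m n) :=
  Ideal.span {x | ∃ (i : Fin m) (j : Fin n), (j : ℕ) < n - 1 ∧ x = detx 𝕜 m n i j}

/-- The formal power series ring `S = 𝕜[[x_1, …, x_m, a_1, …, a_{n-1}]]`. -/
abbrev DetS := MvPowerSeries (Fin m ⊕ Fin (n - 1)) 𝕜

/-- The ideal `𝔞 = (a_1, …, a_{n-1})S`. -/
def detA : Ideal (DetS 𝕜 m n) :=
  Ideal.span {f | ∃ j : Fin (n - 1), f = X (Sum.inr j)}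

/-- The property pinning down the local `𝕜`-algebra homomorphism `φ : R → S`:
`x_{ij} ↦ a_j·x_i` for `1 ≤ j ≤ n-1` and `x_{in} ↦ x_i` (in `0`-based indexing, the last
column is `j = n-1`).  Any `𝕜`-algebra homomorphism `R → S` with these values on the
variables automatically maps the maximal ideal into the maximal ideal, hence is continuous
and is uniquely determined by these values; so this predicate characterizes `φ`. -/
def IsDetPhi (φ : DetR 𝕜 m n →ₐ[𝕜] DetS 𝕜 m n) : Prop :=
  ∀ (i : Fin m) (j : Fin n),
    φ (detx 𝕜 m n i j) =
      if h : (j : ℕ) < n - 1 then X (Sum.inr (⟨j, h⟩ : Fin (n - 1))) * X (Sum.inl i)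
      else X (Sum.inl i)

section ExtComparison

universe v u

variable {A : Type u} [Ring A] {C : Type v} [Category.{u} C] [Abelian C] [Linear A C]

/-- The functor `Hom(-, Y)`, with values in the opposite of the category of modules. -/
abbrev homOp (A : Type u) [Ring A] [Linear A C] (Y : C) : C ⥤ (ModuleCat A)ᵒᵖ :=
  ((linearYoneda A C).obj Y).rightOp

/-- The complex `Hom(P, Y)` of a projective resolution `P`. -/
abbrev homOpComplex (A : Type u) [Ring A] [Linear A C] {X : C} (P : ProjectiveResolution X)
    (Y : C) :
    ChainComplex (ModuleCat A)ᵒᵖ ℕ :=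
  ((homOp A Y).mapHomologicalComplex _).obj P.complex

/-- The inclusion of the `n`-cocycles of `Hom(P, Y)` in `Hom(P_n, Y)`. -/
def cocyc {X : C} (P : ProjectiveResolution X) (Y : C) (n : ℕ) :
    ((homOpComplex A P Y).opcycles n).unop ⟶ ModuleCat.of A (P.complex.X n ⟶ Y) :=
  ((homOpComplex A P Y).pOpcycles n).unop

theorem exists_cocyc {X : C} (P : ProjectiveResolution X) (Y : C) (n : ℕ)
    (f : P.complex.X n ⟶ Y) (hf : P.complex.d (n + 1) n ≫ f = 0) :
    ∃ z, cocyc (A := A) P Y n z = f := by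
  have h0 : (ShortComplex.mk _ _ ((homOpComplex A P Y).d_pOpcycles (n + 1) n)).Exact :=
    ShortComplex.exact_of_g_is_cokernel _
      ((homOpComplex A P Y).opcyclesIsCokernel (n + 1) n (by simp))
  have h := h0.unop
  rw [ShortComplex.moduleCat_exact_iff] at h
  exact h f hf

theorem d_cocyc {X : C} (P : ProjectiveResolution X) (Y : C) (n : ℕ) (z) :
    P.complex.d (n + 1) n ≫ (show P.complex.X n ⟶ Y from cocyc (A := A) P Y n z) = 0 := by
  have h := (congrArg Quiver.Hom.unop ((homOpComplex A P Y).d_pOpcycles (n + 1) n))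
  exact ConcreteCategory.congr_hom h z

theorem cocyc_injective {X : C} (P : ProjectiveResolution X) (Y : C) (n : ℕ) :
    Function.Injective (cocyc (A := A) P Y n) := by
  rw [← ModuleCat.mono_iff_injective]
  exact unop_mono_of_epi ((homOpComplex A P Y).pOpcycles n)

variable [EnoughProjectives C]

/-- `Ext^n(X, Y)` as the cohomology of `Hom(P, Y)`. -/
def extOfHomology (A : Type u) [Ring A] [Linear A C] {X : C} (P : ProjectiveResolution X) (Y : C)
    (n : ℕ) :
    ((homOpComplex A P Y).homology n).unop ≅ ((Ext A C n).obj (op X)).obj Y :=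
  (P.isoLeftDerivedObj (homOp A Y) n).unop

theorem extOfHomology_naturality {X X' : C} (P : ProjectiveResolution X)
    (P' : ProjectiveResolution X')
    (f : X' ⟶ X) (φ : P'.complex ⟶ P.complex) (comm : φ.f 0 ≫ P.π.f 0 = P'.π.f 0 ≫ f)
    (Y : C) (n : ℕ) :
    (extOfHomology A P Y n).hom ≫ ((Ext A C n).map f.op).app Y =
      (HomologicalComplex.homologyMap (((homOp A Y).mapHomologicalComplex _).map φ) n).unop ≫
        (extOfHomology A P' Y n).hom :=
  congrArg Quiver.Hom.unop
    (P'.isoLeftDerivedObj_hom_naturality f P φ comm (homOp A Y) n)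

/-- The class in `Ext^n(X, Y)` of a cocycle of `Hom(P, Y)`. -/
def cls {X : C} (P : ProjectiveResolution X) (Y : C) (n : ℕ) :
    ((homOpComplex A P Y).opcycles n).unop ⟶ ((Ext A C n).obj (op X)).obj Y :=
  ((homOpComplex A P Y).homologyι n).unop ≫ (extOfHomology A P Y n).hom

theorem cls_surjective {X : C} (P : ProjectiveResolution X) (Y : C) (n : ℕ) :
    Function.Surjective (cls (A := A) P Y n) := by
  rw [← ModuleCat.epi_iff_surjective]
  unfold cls
  infer_instance

theorem cls_eq_zero_iff {X : C} (P : ProjectiveResolution X) (Y : C) (n : ℕ) (z) :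
    cls (A := A) P Y (n + 1) z = 0 ↔
      ∃ g : P.complex.X n ⟶ Y, P.complex.d (n + 1) n ≫ g = cocyc (A := A) P Y (n + 1) z := by
  have h0 : (ShortComplex.mk _ _
      ((homOpComplex A P Y).homologyι_comp_fromOpcycles (n + 1) n)).Exact :=
    ShortComplex.exact_of_f_is_kernel _
      ((homOpComplex A P Y).homologyIsKernel (n + 1) n (by simp))
  have h := h0.unop
  rw [ShortComplex.moduleCat_exact_iff] at h
  have h2 : ((homOpComplex A P Y).fromOpcycles (n + 1) n).unop ≫ cocyc (A := A) P Y (n + 1)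
    = ((homOpComplex A P Y).d (n + 1) n).unop :=
     (congrArg Quiver.Hom.unop ((homOpComplex A P Y).p_fromOpcycles (n + 1) n))
  have h3 : ((homOpComplex A P Y).fromOpcycles (n + 1) n).unop ≫
    ((homOpComplex A P Y).homologyι (n + 1)).unop = 0 :=
     (congrArg Quiver.Hom.unop ((homOpComplex A P Y).homologyι_comp_fromOpcycles (n + 1) n))
  constructor
  · intro hz
    obtain ⟨g, hg⟩ := h z (by
      apply (ModuleCat.mono_iff_injective (extOfHomology A P Y (n + 1)).hom).1 inferInstance
      exact hz.trans (map_zero _).symm)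
    refine ⟨g, ?_⟩
    rw [← hg]
    exact (ConcreteCategory.congr_hom h2 g).symm
  · rintro ⟨g, hg⟩
    have : z = ((homOpComplex A P Y).fromOpcycles (n + 1) n).unop g := by
      apply cocyc_injective
      rw [← hg]
      exact (ConcreteCategory.congr_hom h2 g).symm
    have h4 : ((homOpComplex A P Y).fromOpcycles (n + 1) n).unop ≫
        cls (A := A) P Y (n + 1) = 0 := by
      rw [cls, ← Category.assoc, h3, Limits.zero_comp]
    rw [this]
    exact ConcreteCategory.congr_hom h4 g

theorem cls_zero_injective {X : C} (P : ProjectiveResolution X) (Y : C) :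
    Function.Injective (cls (A := A) P Y 0) := by
  have := (homOpComplex A P Y).isIso_homologyι 0 0 (by simp) (by simp)
  rw [← ModuleCat.mono_iff_injective]
  unfold cls
  infer_instance

theorem cls_naturality {X X' : C} (P : ProjectiveResolution X) (P' : ProjectiveResolution X')
    (f : X' ⟶ X) (φ : P'.complex ⟶ P.complex) (comm : φ.f 0 ≫ P.π.f 0 = P'.π.f 0 ≫ f)
    (Y : C) (n : ℕ) (z z') (h : cocyc (A := A) P' Y n z' =
      φ.f n ≫ (show P.complex.X n ⟶ Y from cocyc (A := A) P Y n z)) :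
    ((Ext A C n).map f.op).app Y (cls P Y n z) = cls P' Y n z' := by
  let ψ : homOpComplex A P' Y ⟶ homOpComplex A P Y := ((homOp A Y).mapHomologicalComplex _).map φ
  have h1 : (HomologicalComplex.opcyclesMap ψ n).unop ≫ cocyc (A := A) P' Y n =
      cocyc (A := A) P Y n ≫ (ψ.f n).unop :=
    congrArg Quiver.Hom.unop (HomologicalComplex.p_opcyclesMap ψ n)
  have h2 : z' = (HomologicalComplex.opcyclesMap ψ n).unop z := by
    apply cocyc_injective
    rw [h]
    exact (ConcreteCategory.congr_hom h1 z).symm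
  have h3 : ((homOpComplex A P Y).homologyι n).unop ≫ (HomologicalComplex.homologyMap ψ n).unop =
      (HomologicalComplex.opcyclesMap ψ n).unop ≫ ((homOpComplex A P' Y).homologyι n).unop :=
    congrArg Quiver.Hom.unop (HomologicalComplex.homologyι_naturality ψ n)
  have h4 : cls (A := A) P Y n ≫ ((Ext A C n).map f.op).app Y =
      (HomologicalComplex.opcyclesMap ψ n).unop ≫ cls (A := A) P' Y n := by
    unfold cls
    rw [Category.assoc, extOfHomology_naturality P P' f φ comm, ← Category.assoc, h3,
      Category.assoc]
  rw [h2]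
  exact ConcreteCategory.congr_hom h4 z

variable [HasExt.{u} C]

theorem subsingleton_ext_iff (X Y : C) (n : ℕ) :
    Subsingleton (((Ext A C n).obj (op X)).obj Y) ↔ Subsingleton (Abelian.Ext X Y n) := by
  let P := projectiveResolution X
  cases n with
  | zero =>
    have e : Subsingleton (Abelian.Ext X Y 0) ↔ ∀ g : X ⟶ Y, g = 0 := by
      rw [Abelian.Ext.addEquiv₀.toEquiv.subsingleton_congr]
      exact ⟨fun h g => Subsingleton.elim _ _, fun h => ⟨fun a b => (h a).trans (h b).symm⟩⟩
    rw [e]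
    constructor
    · intro h g
      obtain ⟨z, hz⟩ := exists_cocyc (A := A) P Y 0 (P.π.f 0 ≫ g) ((Category.assoc _ _ _).symm.trans
          ((congrArg (· ≫ g) P.complex_d_comp_π_f_zero).trans Limits.zero_comp))
      have : z = 0 := cls_zero_injective P Y (Subsingleton.elim _ _)
      rw [this, map_zero] at hz
      exact (cancel_epi (P.π.f 0)).1 (hz.symm.trans (Limits.comp_zero).symm)
    · intro h
      refine ⟨fun a b => ?_⟩
      obtain ⟨a, rfl⟩ := cls_surjective P Y 0 a
      obtain ⟨b, rfl⟩ := cls_surjective P Y 0 b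
      congr 1
      apply cocyc_injective
      have key : ∀ z, cocyc (A := A) P Y 0 z = 0 := by
        intro z
        have hd := d_cocyc P Y 0 z
        obtain ⟨g, hg⟩ : ∃ g : X ⟶ Y, P.π.f 0 ≫ g = cocyc (A := A) P Y 0 z :=
          ⟨P.exact₀.desc _ hd, P.exact₀.g_desc _ hd⟩
        rw [← hg, h g]
        exact Limits.comp_zero
      rw [key, key]
  | succ n =>
    have e1 : Subsingleton (((Ext A C (n + 1)).obj (op X)).obj Y) ↔
        ∀ f : P.complex.X (n + 1) ⟶ Y, P.complex.d (n + 1 + 1) (n + 1) ≫ f = 0 →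
          ∃ g : P.complex.X n ⟶ Y, P.complex.d (n + 1) n ≫ g = f := by
      rw [subsingleton_iff_forall_eq 0]
      constructor
      · intro h f hf
        obtain ⟨z, rfl⟩ := exists_cocyc (A := A) P Y (n + 1) f hf
        exact (cls_eq_zero_iff P Y n z).1 (h _)
      · intro h a
        obtain ⟨z, rfl⟩ := cls_surjective P Y (n + 1) a
        exact (cls_eq_zero_iff P Y n z).2 (h _ (d_cocyc P Y _ z))
    rw [e1, subsingleton_iff_forall_eq 0]
    constructor
    · intro h a
      obtain ⟨f, hf, rfl⟩ := P.extMk_surjective a _ rfl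
      exact (P.extMk_eq_zero_iff f _ rfl hf n rfl).2 (h f hf)
    · intro h f hf
      exact (P.extMk_eq_zero_iff f _ rfl hf n rfl).1 (h _)

theorem ext_map_injective {X X' : C} (f : X' ⟶ X) (Y : C) (n : ℕ)
    (h : ∀ x : Abelian.Ext X Y (n + 1), (Abelian.Ext.mk₀ f).comp x (zero_add _) = 0 → x = 0) :
    Function.Injective (((Ext A C (n + 1)).map f.op).app Y) := by
  rw [injective_iff_map_eq_zero]
  intro a ha
  let P := projectiveResolution X
  let P' := projectiveResolution X'
  obtain ⟨z, rfl⟩ := cls_surjective P Y (n + 1) a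
  have hz := d_cocyc P Y _ z
  let φ := ProjectiveResolution.lift f P' P
  have comm : φ.f 0 ≫ P.π.f 0 = P'.π.f 0 ≫ f := ProjectiveResolution.lift_commutes_zero f P' P
  let Φ : ProjectiveResolution.Hom P' P f := ⟨φ, by simpa using comm⟩
  have hz' : P'.complex.d (n + 1 + 1) (n + 1) ≫ φ.f (n + 1) ≫
    (show P.complex.X (n + 1) ⟶ Y from cocyc (A := A) P Y (n + 1) z) = 0 := by
    rw [← φ.comm_assoc, hz, Limits.comp_zero]
  obtain ⟨z', hzz⟩ := exists_cocyc (A := A) P' Y (n + 1) _ hz'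
  rw [cls_naturality P P' f φ comm Y (n + 1) z z' hzz, cls_eq_zero_iff, hzz] at ha
  rw [cls_eq_zero_iff]
  have := h (P.extMk _ _ rfl hz) (by
    rw [P.mk₀_comp_extMk _ _ rfl hz Φ]
    exact (P'.extMk_eq_zero_iff _ _ rfl _ n rfl).2 ha)
  exact (P.extMk_eq_zero_iff _ _ rfl _ n rfl).1 this

end ExtComparison

section LocalCohomologyCriteria

open Limits

variable {R : Type} [CommRing R]

theorem subsingleton_colimit_of_forall {K : Type} [SmallCategory K]
    (F : K ⥤ ModuleCat.{0} R)
    (h : ∀ k, Subsingleton (F.obj k)) : Subsingleton (colimit F : ModuleCat R) := by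
  apply ModuleCat.subsingleton_of_isZero
  rw [IsZero.iff_id_eq_zero]
  refine colimit.hom_ext fun k => ?_
  exact (ModuleCat.isZero_of_subsingleton (F.obj k)).eq_of_src _ _

theorem not_subsingleton_colimit_of_injective (F : (ℕᵒᵖ)ᵒᵖ ⥤ ModuleCat.{0} R)
    (h : ∀ t, Function.Injective (F.map (homOfLE (Nat.le_succ t)).op.op))
    (t : ℕ) (ht : ¬ Subsingleton (F.obj (op (op t)))) :
    ¬ Subsingleton (colimit F : ModuleCat R) := by
  have key : ∀ (k : ℕ) (f : op (op t) ⟶ op (op (t + k))), Function.Injective (F.map f) := by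
    intro k
    induction k with
    | zero =>
      intro f
      obtain rfl : f = 𝟙 _ := Quiver.Hom.unop_inj (Quiver.Hom.unop_inj (Subsingleton.elim _ _))
      rw [F.map_id]
      exact fun a b hab => hab
    | succ k ih =>
      intro f
      obtain rfl : f = (homOfLE (Nat.le_add_right t k)).op.op ≫
          (homOfLE (Nat.le_succ (t + k))).op.op :=
        Quiver.Hom.unop_inj (Quiver.Hom.unop_inj (Subsingleton.elim _ _))
      rw [F.map_comp]
      exact (h (t + k)).comp (ih _)
  intro hs
  refine ht ⟨fun a b => ?_⟩
  obtain ⟨⟨⟨s⟩⟩, f, g, hfg⟩ := Concrete.colimit_exists_of_rep_eq (C := ModuleCat R) F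
    (i := op (op t)) (j := op (op t)) a b
    (Subsingleton.elim _ _)
  obtain ⟨k, rfl⟩ := Nat.exists_eq_add_of_le f.unop.unop.le
  have e : f = g := Quiver.Hom.unop_inj (Quiver.Hom.unop_inj (Subsingleton.elim _ _))
  exact key k f (hfg.trans (by rw [e]))

/-- The transition map `R/J^(t+1) → R/J^t`. -/
abbrev powTransition (J : Ideal R) (t : ℕ) :
    ModuleCat.of R (R ⧸ J ^ (t + 1)) ⟶ ModuleCat.of R (R ⧸ J ^ t) :=
  ModuleCat.ofHom (Submodule.mapQ _ _ LinearMap.id (Ideal.pow_le_pow_right (Nat.le_succ t)))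

theorem subsingleton_localCohomology (J : Ideal R) (ω : ModuleCat.{0} R) (i : ℕ)
    (h : ∀ t, Subsingleton (Abelian.Ext (ModuleCat.of R (R ⧸ J ^ t)) ω i)) :
    Subsingleton ((localCohomology J i).obj ω) := by
  let D := localCohomology.diagram (localCohomology.idealPowersDiagram J) i
  let F := D ⋙ (evaluation _ _).obj ω
  have e : (localCohomology J i).obj ω ≅ colimit F :=
    colimitObjIsoColimitCompEvaluation D ω
  have := subsingleton_colimit_of_forall F (fun k =>
    (subsingleton_ext_iff (A := R) _ ω i).2 (h k.unop.unop))
  exact e.toLinearEquiv.toEquiv.subsingleton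

theorem not_subsingleton_localCohomology (J : Ideal R) (ω : ModuleCat.{0} R) (i : ℕ)
    (h : ∀ t, ∀ x : Abelian.Ext (ModuleCat.of R (R ⧸ J ^ t)) ω (i + 1),
      (Abelian.Ext.mk₀ (powTransition J t)).comp x (zero_add _) = 0 → x = 0)
    (t : ℕ) (ht : ¬ Subsingleton (Abelian.Ext (ModuleCat.of R (R ⧸ J ^ t)) ω (i + 1))) :
    ¬ Subsingleton ((localCohomology J (i + 1)).obj ω) := by
  let D := localCohomology.diagram (localCohomology.idealPowersDiagram J) (i + 1)
  let F := D ⋙ (evaluation _ _).obj ω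
  have e : (localCohomology J (i + 1)).obj ω ≅ colimit F :=
    colimitObjIsoColimitCompEvaluation D ω
  have := not_subsingleton_colimit_of_injective F
    (fun t => ext_map_injective (A := R) (powTransition J t) ω i (h t)) t
    (fun hs => ht ((subsingleton_ext_iff (A := R) _ ω (i + 1)).1 hs))
  exact fun hs => this e.symm.toLinearEquiv.toEquiv.subsingleton

end LocalCohomologyCriteria

section Subquotients

variable {R : Type} [CommRing R] {S : Type} [AddCommGroup S] [Module R S]

/-- The subquotient `W / (W ∩ U)` of a module. -/
abbrev Subquotient (W U : Submodule R S) : Type := W ⧸ U.submoduleOf W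

/-- The projection between subquotients with the same numerator. -/
def Subquotient.factor (W : Submodule R S) {U V : Submodule R S} (h : U ≤ V) :
    Subquotient W U →ₗ[R] Subquotient W V :=
  Submodule.factor (Submodule.comap_mono h)

theorem Subquotient.factor_surjective (W : Submodule R S) {U V : Submodule R S} (h : U ≤ V) :
    Function.Surjective (Subquotient.factor W h) :=
  Submodule.factor_surjective (Submodule.comap_mono h)

/-- The inclusion of a subquotient in a quotient. -/
def Subquotient.inclusion (W U : Submodule R S) : Subquotient W U →ₗ[R] S ⧸ U :=
  Submodule.mapQ _ _ W.subtype le_rfl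

theorem Subquotient.inclusion_injective (W U : Submodule R S) :
    Function.Injective (Subquotient.inclusion W U) := by
  rw [← LinearMap.ker_eq_bot, eq_bot_iff]
  intro y hy
  obtain ⟨r, rfl⟩ := Submodule.Quotient.mk_surjective _ y
  exact (Submodule.Quotient.mk_eq_zero _).2 ((Submodule.Quotient.mk_eq_zero U).1 hy)

theorem Subquotient.inclusion_top_surjective (U : Submodule R S) :
    Function.Surjective (Subquotient.inclusion ⊤ U) := by
  intro y
  obtain ⟨s, rfl⟩ := Submodule.Quotient.mk_surjective _ y
  exact ⟨Submodule.Quotient.mk ⟨s, trivial⟩, rfl⟩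

theorem Subquotient.range_inclusion {W U : Submodule R S} (h : U ≤ W) :
    LinearMap.range (Subquotient.inclusion W U) = LinearMap.ker (Submodule.factor h) := by
  ext y
  obtain ⟨s, rfl⟩ := Submodule.Quotient.mk_surjective _ y
  constructor
  · rintro ⟨r, hr⟩
    obtain ⟨r, rfl⟩ := Submodule.Quotient.mk_surjective _ r
    rw [← hr]
    exact (Submodule.Quotient.mk_eq_zero _).2 r.2
  · intro hs
    exact ⟨Submodule.Quotient.mk ⟨s, (Submodule.Quotient.mk_eq_zero _).1 hs⟩, rfl⟩

theorem Subquotient.smul_injective {W U : Submodule R S} {x : R}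
    (h : ∀ f, x • f ∈ U → f ∈ U) :
    Function.Injective (x • (LinearMap.id : Subquotient W U →ₗ[R] Subquotient W U)) := by
  rw [← LinearMap.ker_eq_bot, eq_bot_iff]
  intro y hy
  obtain ⟨f, rfl⟩ := Submodule.Quotient.mk_surjective _ y
  exact (Submodule.Quotient.mk_eq_zero _).2
    (h f.1 ((Submodule.Quotient.mk_eq_zero (U.submoduleOf W) (x := x • f)).1 hy))

theorem Subquotient.smul_exact {W U V : Submodule R S} {x : R} (hUV : U ≤ V)
    (hg : ∀ f ∈ W, f ∈ V → ∃ g ∈ W, x • g - f ∈ U) (hV : ∀ f, x • f ∈ V) :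
    Function.Exact (x • (LinearMap.id : Subquotient W U →ₗ[R] Subquotient W U))
      (Subquotient.factor W hUV) := by
  intro y
  obtain ⟨f, rfl⟩ := Submodule.Quotient.mk_surjective _ y
  constructor
  · intro hf
    obtain ⟨g, hgW, hgU⟩ := hg f.1 f.2 ((Submodule.Quotient.mk_eq_zero (V.submoduleOf W)).1 hf)
    exact ⟨Submodule.Quotient.mk ⟨g, hgW⟩, (Submodule.Quotient.eq (U.submoduleOf W)).2 hgU⟩
  · rintro ⟨z, hz⟩
    obtain ⟨g, rfl⟩ := Submodule.Quotient.mk_surjective _ z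
    rw [← hz]
    exact (Submodule.Quotient.mk_eq_zero (V.submoduleOf W)).2 (hV g.1)

end Subquotients

section ExtVanishing

variable {R : Type} [CommRing R] {N' N N'' : Type} [AddCommGroup N'] [AddCommGroup N]
  [AddCommGroup N''] [Module R N'] [Module R N] [Module R N''] {f : N' →ₗ[R] N} {g : N →ₗ[R] N''}

/-- `Ext^i(N, ω) = 0`. -/
def ExtVanishes (N : Type) [AddCommGroup N] [Module R N] (ω : ModuleCat.{0} R) (i : ℕ) : Prop :=
  ∀ x : Abelian.Ext (ModuleCat.of R N) ω i, x = 0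

theorem extVanishes_iff_subsingleton {ω : ModuleCat.{0} R} {i : ℕ} :
    ExtVanishes N ω i ↔ Subsingleton (Abelian.Ext (ModuleCat.of R N) ω i) :=
  (subsingleton_iff_forall_eq 0).symm

/-- The short complex of modules attached to two composable linear maps. -/
abbrev linearShortComplex (hfg : Function.Exact f g) : ShortComplex (ModuleCat.{0} R) :=
  ShortComplex.mk (ModuleCat.ofHom f) (ModuleCat.ofHom g) (by
    ext x; exact hfg.apply_apply_eq_zero x)

theorem linearShortComplex_shortExact (hf : Function.Injective f) (hg : Function.Surjective g)
    (hfg : Function.Exact f g) : (linearShortComplex hfg).ShortExact where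
  exact := by
    rw [ShortComplex.moduleCat_exact_iff]
    exact fun x hx => (hfg x).1 hx
  mono_f := (ModuleCat.mono_iff_injective _).2 hf
  epi_g := (ModuleCat.epi_iff_surjective _).2 hg

variable {ω : ModuleCat.{0} R} {i : ℕ}

theorem ExtVanishes.middle (hf : Function.Injective f) (hg : Function.Surjective g)
    (hfg : Function.Exact f g) (h' : ExtVanishes N' ω i) (h'' : ExtVanishes N'' ω i) :
    ExtVanishes N ω i := by
  intro x
  obtain ⟨y, rfl⟩ := Abelian.Ext.contravariant_sequence_exact₂
    (linearShortComplex_shortExact hf hg hfg) _ x (h' _)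
  rw [h'' y, Abelian.Ext.comp_zero]

theorem ExtVanishes.left (hf : Function.Injective f) (hg : Function.Surjective g)
    (hfg : Function.Exact f g) (h : ExtVanishes N ω i) (h'' : ExtVanishes N'' ω (i + 1)) :
    ExtVanishes N' ω i := by
  intro x
  obtain ⟨y, rfl⟩ := Abelian.Ext.contravariant_sequence_exact₁
    (linearShortComplex_shortExact hf hg hfg) _ x (add_comm 1 i) (h'' _)
  rw [h y, Abelian.Ext.comp_zero]

theorem ExtVanishes.right (hf : Function.Injective f) (hg : Function.Surjective g)
    (hfg : Function.Exact f g) (h' : ExtVanishes N' ω i) (h : ExtVanishes N ω (i + 1)) :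
    ExtVanishes N'' ω (i + 1) := by
  intro x
  obtain ⟨y, rfl⟩ := Abelian.Ext.contravariant_sequence_exact₃
    (linearShortComplex_shortExact hf hg hfg) _ x (h _) (add_comm 1 i)
  rw [h' y, Abelian.Ext.comp_zero]

theorem ext_precomp_injective_of_surjective (hg : Function.Surjective g)
    (h' : ExtVanishes (LinearMap.ker g) ω i) (x : Abelian.Ext (ModuleCat.of R N'') ω (i + 1))
    (hx : (Abelian.Ext.mk₀ (ModuleCat.ofHom g)).comp x (zero_add _) = 0) : x = 0 := by
  obtain ⟨y, rfl⟩ := Abelian.Ext.contravariant_sequence_exact₃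
    (linearShortComplex_shortExact (f := (LinearMap.ker g).subtype)
      Subtype.val_injective hg (LinearMap.exact_subtype_ker_map g)) _ x hx (add_comm 1 i)
  rw [h' y, Abelian.Ext.comp_zero]

theorem ExtVanishes.congr (e : N ≃ₗ[R] N'') (h : ExtVanishes N ω i) : ExtVanishes N'' ω i := by
  intro x
  have h1 : ModuleCat.ofHom e.symm.toLinearMap ≫ ModuleCat.ofHom e.toLinearMap = 𝟙 _ := by
    ext y; simp
  rw [← Abelian.Ext.mk₀_id_comp x, ← h1, ← Abelian.Ext.mk₀_comp_mk₀_assoc,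
    h ((Abelian.Ext.mk₀ _).comp x _), Abelian.Ext.comp_zero]

/-- `Ext^i(N, ω) = 0` for all `i ≠ c`. -/
def ExtConcentrated (N : Type) [AddCommGroup N] [Module R N] (ω : ModuleCat.{0} R) (c : ℕ) : Prop :=
  ∀ i, i ≠ c → ExtVanishes N ω i

theorem ExtConcentrated.congr {c : ℕ} (e : N ≃ₗ[R] N'') (h : ExtConcentrated N ω c) :
    ExtConcentrated N'' ω c :=
  fun i hi => (h i hi).congr e

theorem isFiniteLength_ext [IsLocalRing R] {d : ℕ}
    (h0 : ExtConcentrated (IsLocalRing.ResidueField R) ω (d + 1))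
    (h1 : ¬ ExtVanishes (IsLocalRing.ResidueField R) ω (d + 1)) (hN : IsFiniteLength R N) :
    ExtConcentrated N ω (d + 1) ∧ (Nontrivial N → ¬ ExtVanishes N ω (d + 1)) := by
  have hz : ∀ (M : Type) [AddCommGroup M] [Module R M] [Subsingleton M] (i : ℕ),
      ExtVanishes M ω i := by
    intro M _ _ _ i x
    rw [← Abelian.Ext.mk₀_id_comp x,
      (ModuleCat.isZero_of_subsingleton (ModuleCat.of R M)).eq_of_src (𝟙 _) 0,
      Abelian.Ext.mk₀_zero, Abelian.Ext.zero_comp]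
  induction hN with
  | of_subsingleton =>
    exact ⟨fun i _ => hz _ i, fun h => absurd h (not_nontrivial _)⟩
  | @of_simple_quotient M _ _ L hs hL ih =>
    obtain ⟨I, hI, ⟨e⟩⟩ := isSimpleModule_iff_quot_maximal.1 hs
    obtain rfl := IsLocalRing.eq_maximalIdeal hI
    have e' : IsLocalRing.ResidueField R ≃ₗ[R] (M ⧸ L) := e.symm
    have hLi : Function.Injective L.subtype := Subtype.val_injective
    have hLs := L.mkQ_surjective
    have hex : Function.Exact L.subtype L.mkQ := LinearMap.exact_subtype_mkQ L
    refine ⟨fun i hi => (ih.1 i hi).middle hLi hLs hex ((h0 i hi).congr e'), fun _ hv => ?_⟩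
    exact h1 (((ih.1 d (by omega)).right hLi hLs hex hv).congr e'.symm)

section Regular

variable [IsNoetherianRing R] [IsLocalRing R]

theorem ExtVanishes.of_regular [Module.Finite R N] [Module.Finite R ω] {x : R}
    (hx : x ∈ IsLocalRing.maximalIdeal R)
    (hinj : Function.Injective (x • (LinearMap.id : N →ₗ[R] N)))
    (hg : Function.Surjective g) (hex : Function.Exact (x • (LinearMap.id : N →ₗ[R] N)) g)
    (h : ExtVanishes N'' ω (i + 1)) : ExtVanishes N ω i := by
  have key : (⊤ : Submodule R (Abelian.Ext (ModuleCat.of R N) ω i)) = ⊥ := by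
    refine Submodule.eq_bot_of_le_smul_of_le_jacobson_bot (IsLocalRing.maximalIdeal R) ⊤
      (Module.Finite.fg_top) ?_ ?_
    · intro y _
      obtain ⟨z, rfl⟩ := Abelian.Ext.contravariant_sequence_exact₁
        (linearShortComplex_shortExact hinj hg hex) _ y (add_comm 1 i) (h _)
      have : (linearShortComplex hex).f = x • 𝟙 _ := by
        ext; rfl
      rw [this, Abelian.Ext.mk₀_smul, Abelian.Ext.smul_comp, Abelian.Ext.mk₀_id_comp]
      exact Submodule.smul_mem_smul hx trivial
    · rw [IsLocalRing.jacobson_eq_maximalIdeal _ bot_ne_top]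
  intro y
  have : y ∈ (⊤ : Submodule R (Abelian.Ext (ModuleCat.of R N) ω i)) := trivial
  rwa [key] at this

/-- Going down along a chain of modules, each the quotient of the previous one by a
non-zero-divisor, lowers the degree in which `Ext(-, ω)` is concentrated. -/
theorem ExtConcentrated.of_chain [Module.Finite R ω] (k : ℕ) :
    ∀ (c : ℕ) (N : ℕ → Type) [∀ j, AddCommGroup (N j)] [∀ j, Module R (N j)]
      [Module.Finite R (N 0)] (x : ℕ → R) (_ : ∀ j, x j ∈ IsLocalRing.maximalIdeal R)
      (g : ∀ j, N j →ₗ[R] N (j + 1))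
      (_ : ∀ j < k, Function.Injective (x j • (LinearMap.id : N j →ₗ[R] N j)))
      (_ : ∀ j < k, Function.Surjective (g j))
      (_ : ∀ j < k, Function.Exact (x j • (LinearMap.id : N j →ₗ[R] N j)) (g j))
      (_ : ExtConcentrated (N k) ω (c + k)),
      ExtConcentrated (N 0) ω c ∧
        (¬ ExtVanishes (N k) ω (c + k) → ¬ ExtVanishes (N 0) ω c) := by
  induction k with
  | zero => exact fun c N _ _ _ x _ g _ _ _ h => ⟨h, id⟩
  | succ k ih =>
    intro c N _ _ _ x hx g hinj hsurj hex h
    have hfin : Module.Finite R (N (0 + 1)) :=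
      Module.Finite.of_surjective (g 0) (hsurj 0 k.succ_pos)
    have hc : c + (k + 1) = c + 1 + k := by omega
    rw [hc] at h ⊢
    obtain ⟨h1, h2⟩ := ih (c + 1) (fun j => N (j + 1)) (fun j => x (j + 1)) (fun j => hx _)
      (fun j => g (j + 1)) (fun j hj => hinj _ (by omega)) (fun j hj => hsurj _ (by omega))
      (fun j hj => hex _ (by omega)) h
    have h3 : ExtConcentrated (N 0) ω c := fun i hi =>
      (h1 (i + 1) (by omega)).of_regular (hx 0) (hinj 0 k.succ_pos) (hsurj 0 k.succ_pos)
        (hex 0 k.succ_pos)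
    refine ⟨h3, fun hne hv => h2 hne ?_⟩
    exact hv.right (hinj 0 k.succ_pos) (hsurj 0 k.succ_pos) (hex 0 k.succ_pos)
      (h3 (c + 1) (by omega))

end Regular

end ExtVanishing

section TwoDegrees

variable {R : Type} [CommRing R] [IsLocalRing R] {S : Type} [AddCommGroup S] [Module R S]

/-- Local cohomology of `ω` along `J`, when the powers of `J` are contracted from a
filtration `M` of a module `S ⊇ R` such that `S / (R + M t)` has finite length. -/
theorem localCohomology_two_degrees {J : Ideal R} {ω : ModuleCat.{0} R} {c e : ℕ}
    (hc : 0 < c) (hce : c < e)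
    (h0 : ExtConcentrated (IsLocalRing.ResidueField R) ω (e + 1))
    (h1 : ¬ ExtVanishes (IsLocalRing.ResidueField R) ω (e + 1))
    (φ : R →ₗ[R] S) (M : ℕ → Submodule R S) (hM : ∀ t, M (t + 1) ≤ M t)
    (hφ : ∀ t r, φ r ∈ M t ↔ r ∈ J ^ t)
    (hfl : ∀ t, IsFiniteLength R (S ⧸ (LinearMap.range φ ⊔ M t)))
    (hnt : ∃ t, Nontrivial (S ⧸ (LinearMap.range φ ⊔ M t)))
    (hS : ∀ t, ExtConcentrated (S ⧸ M t) ω c)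
    (hgr : ∀ t, ExtConcentrated (Subquotient (M t) (M (t + 1))) ω c)
    (hne : ∃ t, ¬ ExtVanishes (S ⧸ M t) ω c) :
    (∀ i, i ≠ c → i ≠ e → Subsingleton ((localCohomology J i).obj ω)) ∧
    ¬ Subsingleton ((localCohomology J c).obj ω) ∧
    ¬ Subsingleton ((localCohomology J e).obj ω) := by
  have hle : ∀ t, (J ^ t : Ideal R) ≤ (M t).comap φ := fun t r hr => (hφ t r).2 hr
  let a : ∀ t, (R ⧸ J ^ t) →ₗ[R] (S ⧸ M t) := fun t => Submodule.mapQ _ _ φ (hle t)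
  let b : ∀ t, (S ⧸ M t) →ₗ[R] (S ⧸ (LinearMap.range φ ⊔ M t)) := fun t =>
    Submodule.factor le_sup_right
  have ha : ∀ t, Function.Injective (a t) := by
    intro t
    rw [← LinearMap.ker_eq_bot, Submodule.ker_mapQ]
    rw [eq_bot_iff]
    rintro _ ⟨r, hr, rfl⟩
    exact (Submodule.Quotient.mk_eq_zero _).2 ((hφ t r).1 hr)
  have hb : ∀ t, Function.Surjective (b t) := fun t => Submodule.factor_surjective _
  have hab : ∀ t, Function.Exact (a t) (b t) := by
    intro t y
    obtain ⟨s, rfl⟩ := Submodule.Quotient.mk_surjective _ y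
    constructor
    · intro hs
      obtain ⟨_, ⟨r, rfl⟩, y, hy, rfl⟩ :=
        Submodule.mem_sup.1 ((Submodule.Quotient.mk_eq_zero _).1 hs)
      refine ⟨Submodule.Quotient.mk r, (Submodule.Quotient.eq _).2 ?_⟩
      simpa using hy
    · rintro ⟨r, hr⟩
      obtain ⟨r, rfl⟩ := Submodule.Quotient.mk_surjective _ r
      rw [← hr]
      exact (Submodule.Quotient.mk_eq_zero _).2 (le_sup_left (a := LinearMap.range φ) ⟨r, rfl⟩)
  have hC : ∀ t, ExtConcentrated (S ⧸ (LinearMap.range φ ⊔ M t)) ω (e + 1) := fun t =>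
    (isFiniteLength_ext h0 h1 (hfl t)).1
  let q : ∀ t, (S ⧸ M (t + 1)) →ₗ[R] (S ⧸ M t) := fun t => Submodule.factor (hM t)
  let u : ∀ t, (S ⧸ (LinearMap.range φ ⊔ M (t + 1))) →ₗ[R] (S ⧸ (LinearMap.range φ ⊔ M t)) :=
    fun t => Submodule.factor (sup_le_sup_left (hM t) _)
  have hqa : ∀ t, ModuleCat.ofHom (a (t + 1)) ≫ ModuleCat.ofHom (q t) =
      powTransition J t ≫ ModuleCat.ofHom (a t) := by
    intro t
    ext
    rfl
  have hqb : ∀ t, ModuleCat.ofHom (q t) ≫ ModuleCat.ofHom (b t) =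
      ModuleCat.ofHom (b (t + 1)) ≫ ModuleCat.ofHom (u t) := by
    intro t
    ext r
    rfl
  refine ⟨fun i hic hie => subsingleton_localCohomology _ _ _ fun t =>
    extVanishes_iff_subsingleton.1 ((hS t i hic).left (ha t) (hb t) (hab t)
      (hC t (i + 1) (by omega))), ?_, ?_⟩
  · obtain ⟨c, rfl⟩ : ∃ c', c = c' + 1 := ⟨c - 1, by omega⟩
    obtain ⟨t₀, ht₀⟩ := hne
    refine not_subsingleton_localCohomology J ω c (fun t x hx => ?_) t₀ fun hs => ht₀ ?_
    · have hSt := fun t => linearShortComplex_shortExact (ha t) (hb t) (hab t)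
      obtain ⟨y, rfl⟩ := Abelian.Ext.contravariant_sequence_exact₁
        (hSt t) _ x (add_comm 1 _) (hC t _ (by omega) _)
      rw [Abelian.Ext.mk₀_comp_mk₀_assoc, ← hqa, ← Abelian.Ext.mk₀_comp_mk₀_assoc] at hx
      obtain ⟨z, hz⟩ := Abelian.Ext.contravariant_sequence_exact₂ (hSt (t + 1)) _ _ hx
      rw [hC _ _ (by omega) z, Abelian.Ext.comp_zero] at hz
      have hker : ExtVanishes (LinearMap.ker (q t)) ω c := by
        exact (hgr t c (by omega)).congr
          ((LinearEquiv.ofInjective _ (Subquotient.inclusion_injective _ _)).trans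
            (LinearEquiv.ofEq _ _ (Subquotient.range_inclusion (hM t))))
      rw [ext_precomp_injective_of_surjective (Submodule.factor_surjective (hM t)) hker y hz.symm,
        Abelian.Ext.comp_zero]
    · exact (extVanishes_iff_subsingleton.2 hs).middle (ha t₀) (hb t₀) (hab t₀)
        (hC t₀ _ (by omega))
  · obtain ⟨e, rfl⟩ : ∃ e', e = e' + 1 := ⟨e - 1, by omega⟩
    obtain ⟨t₀, ht₀⟩ := hnt
    refine not_subsingleton_localCohomology J ω e (fun t x hx => ?_) t₀ fun hs =>
      (isFiniteLength_ext h0 h1 (hfl t₀)).2 ht₀ ?_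
    · have hSt := fun t => linearShortComplex_shortExact (ha t) (hb t) (hab t)
      let Φ : linearShortComplex (hab (t + 1)) ⟶ linearShortComplex (hab t) :=
        { τ₁ := powTransition J t
          τ₂ := ModuleCat.ofHom (q t)
          τ₃ := ModuleCat.ofHom (u t)
          comm₁₂ := (hqa t).symm
          comm₂₃ := hqb t }
      have hnat := (hSt (t + 1)).extClass_naturality (hSt t) Φ
      have hδ : (hSt t).extClass.comp x (add_comm 1 _) = 0 := by
        refine ext_precomp_injective_of_surjective (g := u t) (Submodule.factor_surjective _)
          ?_ _ ?_
        · exact (isFiniteLength_ext h0 h1 ((hfl (t + 1)).of_injective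
            (f := (LinearMap.ker (u t)).subtype) Subtype.val_injective)).1 _ (by omega)
        · have := congrArg (fun z => z.comp x (add_comm 1 (e + 1))) hnat
          simp only at this
          rw [Abelian.Ext.comp_assoc _ _ _ _ (zero_add _) (by omega), hx,
            Abelian.Ext.comp_zero] at this
          rw [this, Abelian.Ext.comp_assoc _ _ _ _ (add_comm 1 (e + 1)) (by omega)]
      obtain ⟨y, rfl⟩ := Abelian.Ext.contravariant_sequence_exact₁ (hSt t) _ x (add_comm 1 _) hδ
      rw [hS t _ (by omega) y, Abelian.Ext.comp_zero]
    · exact (extVanishes_iff_subsingleton.2 hs).right (ha t₀) (hb t₀) (hab t₀)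
        (hS t₀ _ (by omega))

end TwoDegrees

section MonomialIdeals

/-- The ideal of power series supported on an upward closed set of exponents. -/
def monomialSupportIdeal (k : Type) [Field k] {τ : Type} (U : UpperSet (τ →₀ ℕ)) :
    Ideal (MvPowerSeries τ k) where
  carrier := {f | ∀ e, e ∉ U → coeff e f = 0}
  zero_mem' := fun e _ => map_zero _
  add_mem' := fun ha hb e he => by rw [map_add, ha e he, hb e he, add_zero]
  smul_mem' := fun g f hf e he => by
    classical
    rw [smul_eq_mul, coeff_mul]
    refine Finset.sum_eq_zero fun p hp => ?_
    rw [hf p.2 fun h2 => he (U.upper (by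
      rw [← Finset.HasAntidiagonal.mem_antidiagonal.1 hp]; exact le_add_self) h2), mul_zero]

variable {k : Type} [Field k] {τ : Type}

theorem coeff_add_single_X_mul (i : τ) (f : MvPowerSeries τ k) (e : τ →₀ ℕ) :
    coeff (e + Finsupp.single i 1) (X i * f) = coeff e f := by
  rw [X_def, add_comm, coeff_add_monomial_mul, one_mul]

theorem coeff_X_mul_eq_zero {i : τ} (f : MvPowerSeries τ k) {e : τ →₀ ℕ} (he : e i = 0) :
    coeff e (X i * f) = 0 := by
  classical
  rw [X_def, coeff_monomial_mul, if_neg]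
  intro h
  have := h i
  simp [he] at this

variable (R : Type) [CommRing R] (k) [Algebra R (MvPowerSeries τ k)]

/-- `monomialSupportIdeal` as a module over a ring mapping to the power series ring. -/
def supportSubmodule (U : UpperSet (τ →₀ ℕ)) : Submodule R (MvPowerSeries τ k) :=
  (monomialSupportIdeal k U).restrictScalars R

variable {R k}

theorem mem_supportSubmodule {U : UpperSet (τ →₀ ℕ)} {f : MvPowerSeries τ k} :
    f ∈ supportSubmodule k R U ↔ ∀ e, e ∉ U → coeff e f = 0 := Iff.rfl

theorem supportSubmodule_mono {U V : UpperSet (τ →₀ ℕ)} (h : V ≤ U) :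
    supportSubmodule k R U ≤ supportSubmodule k R V :=
  fun _ hf e he => hf e fun hU => he (h hU)

theorem isFiniteLength_quotient_supportSubmodule [Algebra k R]
    [IsScalarTower k R (MvPowerSeries τ k)] {U : UpperSet (τ →₀ ℕ)}
    (hU : (U : Set (τ →₀ ℕ))ᶜ.Finite) :
    IsFiniteLength R (MvPowerSeries τ k ⧸ supportSubmodule k R U) := by
  have := hU.to_subtype
  let c : MvPowerSeries τ k →ₗ[k] ((U : Set (τ →₀ ℕ))ᶜ : Set (τ →₀ ℕ)) → k :=
    LinearMap.pi fun e => coeff e.1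
  have hc : LinearMap.ker c = (supportSubmodule k R U).restrictScalars k := by
    ext f
    rw [LinearMap.mem_ker, funext_iff]
    exact ⟨fun h e he => h ⟨e, he⟩, fun h e => h e.1 e.2⟩
  have hf : Module.Finite k (MvPowerSeries τ k ⧸ LinearMap.ker c) :=
    Module.Finite.equiv c.quotKerEquivRange.symm
  rw [hc] at hf
  have hf' : Module.Finite k (MvPowerSeries τ k ⧸ supportSubmodule k R U) := hf
  rw [isFiniteLength_iff_isNoetherian_isArtinian]
  exact ⟨isNoetherian_of_tower k inferInstance, isArtinian_of_tower k inferInstance⟩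

variable {x : R} {i : τ} {W U V : UpperSet (τ →₀ ℕ)}

theorem mem_supportSubmodule_of_smul_mem (hx : algebraMap R (MvPowerSeries τ k) x = X i)
    (hUi : ∀ e, e + Finsupp.single i 1 ∈ U → e ∈ U) (f : MvPowerSeries τ k)
    (hf : x • f ∈ supportSubmodule k R U) : f ∈ supportSubmodule k R U := by
  intro e he
  have h := hf (e + Finsupp.single i 1) (fun h => he (hUi e h))
  rwa [Algebra.smul_def, hx, coeff_add_single_X_mul] at h

theorem smul_mem_supportSubmodule (hx : algebraMap R (MvPowerSeries τ k) x = X i)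
    (hV : ∀ e, 0 < e i → e ∈ V) (f : MvPowerSeries τ k) :
    x • f ∈ supportSubmodule k R V := by
  intro e he
  rw [Algebra.smul_def, hx]
  exact coeff_X_mul_eq_zero _ (by
    by_contra h0
    exact he (hV e (by omega)))

theorem exists_smul_sub_mem_supportSubmodule (hx : algebraMap R (MvPowerSeries τ k) x = X i)
    (hWi : ∀ e, e + Finsupp.single i 1 ∈ W → e ∈ W)
    (hV : ∀ e, e ∈ V → e ∈ U ∨ 0 < e i) (f : MvPowerSeries τ k)
    (hfW : f ∈ supportSubmodule k R W) (hfV : f ∈ supportSubmodule k R V) :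
    ∃ g ∈ supportSubmodule k R W, x • g - f ∈ supportSubmodule k R U := by
  let g : MvPowerSeries τ k := fun e => coeff (e + Finsupp.single i 1) f
  have hg : ∀ e, coeff e g = coeff (e + Finsupp.single i 1) f := fun e => rfl
  refine ⟨g, fun e he => (hg e).trans (hfW _ fun h => he (hWi e h)), fun e he => ?_⟩
  rw [Algebra.smul_def, hx, map_sub]
  rcases Nat.eq_zero_or_pos (e i) with h0 | h0
  · rw [coeff_X_mul_eq_zero _ h0, hfV e (fun hh => ((hV e) hh).elim he (by omega)), sub_zero]
  · obtain ⟨e', rfl⟩ := exists_add_of_le (Finsupp.single_le_iff.2 h0 : Finsupp.single i 1 ≤ e)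
    rw [add_comm, coeff_add_single_X_mul, hg, sub_self]

end MonomialIdeals

section Exponents

variable {𝕜 m n}

/-- The total degree in the variables `x_i` of an exponent of `S`. -/
def rowDeg : (Fin m ⊕ Fin (n - 1) →₀ ℕ) →+ ℕ where
  toFun e := ∑ i, e (Sum.inl i)
  map_zero' := by simp
  map_add' a b := by simp [Finset.sum_add_distrib]

/-- The total degree in the variables `a_j` of an exponent of `S`. -/
def colDeg : (Fin m ⊕ Fin (n - 1) →₀ ℕ) →+ ℕ where
  toFun e := ∑ j, e (Sum.inr j)
  map_zero' := by simp
  map_add' a b := by simp [Finset.sum_add_distrib]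

theorem rowDeg_mono : Monotone (rowDeg (m := m) (n := n)) :=
  fun _ _ h => Finset.sum_le_sum (s := Finset.univ) fun i _ => h (Sum.inl i)

theorem colDeg_mono : Monotone (colDeg (m := m) (n := n)) :=
  fun _ _ h => Finset.sum_le_sum (s := Finset.univ) fun j _ => h (Sum.inr j)

theorem apply_inl_le_rowDeg (e : Fin m ⊕ Fin (n - 1) →₀ ℕ) (i : Fin m) :
    e (Sum.inl i) ≤ rowDeg e :=
  Finset.single_le_sum (f := fun i => e (Sum.inl i)) (fun _ _ => Nat.zero_le _) (Finset.mem_univ i)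

theorem apply_inr_le_colDeg (e : Fin m ⊕ Fin (n - 1) →₀ ℕ) (j : Fin (n - 1)) :
    e (Sum.inr j) ≤ colDeg e :=
  Finset.single_le_sum (f := fun j => e (Sum.inr j)) (fun _ _ => Nat.zero_le _) (Finset.mem_univ j)

theorem exists_inl_pos_of_rowDeg_pos {e : Fin m ⊕ Fin (n - 1) →₀ ℕ} (h : 0 < rowDeg e) :
    ∃ i, 0 < e (Sum.inl i) := by
  obtain ⟨i, -, hi⟩ := (Finset.sum_pos_iff (s := Finset.univ) (f := fun i => e (Sum.inl i))).1 h
  exact ⟨i, hi⟩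

theorem exists_inr_pos_of_colDeg_pos {e : Fin m ⊕ Fin (n - 1) →₀ ℕ} (h : 0 < colDeg e) :
    ∃ j, 0 < e (Sum.inr j) := by
  obtain ⟨i, -, hi⟩ := (Finset.sum_pos_iff (s := Finset.univ) (f := fun i => e (Sum.inr i))).1 h
  exact ⟨i, hi⟩

@[simp] theorem rowDeg_single_inl (i : Fin m) (c : ℕ) :
    rowDeg (n := n) (Finsupp.single (Sum.inl i) c) = c := by
  simp [rowDeg, Finsupp.single_apply]

@[simp] theorem rowDeg_single_inr (j : Fin (n - 1)) (c : ℕ) :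
    rowDeg (m := m) (Finsupp.single (Sum.inr j) c) = 0 := by
  simp [rowDeg]

@[simp] theorem colDeg_single_inl (i : Fin m) (c : ℕ) :
    colDeg (n := n) (Finsupp.single (Sum.inl i) c) = 0 := by
  simp [colDeg]

@[simp] theorem colDeg_single_inr (j : Fin (n - 1)) (c : ℕ) :
    colDeg (m := m) (Finsupp.single (Sum.inr j) c) = c := by
  simp [colDeg, Finsupp.single_apply]

/-- The exponent of the image in `S` of the monomial of `P` with a given exponent: its row sums
and its first `n - 1` column sums. -/
def marginals : (Fin m × Fin n →₀ ℕ) →+ (Fin m ⊕ Fin (n - 1) →₀ ℕ) where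
  toFun d := Finsupp.equivFunOnFinite.symm (Sum.elim (fun i => ∑ j, d (i, j))
    (fun j => ∑ i, d (i, ⟨j, j.2.trans_le (Nat.sub_le n 1)⟩)))
  map_zero' := by ext (i | j) <;> simp
  map_add' a b := by ext (i | j) <;> simp [Finset.sum_add_distrib]

theorem marginals_inl (d : Fin m × Fin n →₀ ℕ) (i : Fin m) :
    marginals d (Sum.inl i) = ∑ j, d (i, j) := rfl

theorem marginals_inr (d : Fin m × Fin n →₀ ℕ) (j : Fin (n - 1)) :
    marginals d (Sum.inr j) = ∑ i, d (i, ⟨j, j.2.trans_le (Nat.sub_le n 1)⟩) := rfl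

theorem marginals_single (i : Fin m) (j : Fin n) (c : ℕ) :
    marginals (Finsupp.single (i, j) c) =
      Finsupp.single (Sum.inl i) c +
        if h : (j : ℕ) < n - 1 then Finsupp.single (Sum.inr ⟨j, h⟩) c else 0 := by
  ext (k | l)
  · rw [marginals_inl]
    by_cases hk : i = k
    · subst hk
      split_ifs <;> simp [Finsupp.single_apply, Prod.ext_iff]
    · split_ifs <;> simp [Prod.ext_iff, hk]
  · rw [marginals_inr]
    by_cases h : (j : ℕ) < n - 1
    · rw [dif_pos h, Finset.sum_eq_single i (by simp +contextual [eq_comm])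
        (by simp)]
      simp [Finsupp.single_apply, Fin.ext_iff]
    · have : (j : ℕ) ≠ l := fun hh => h (hh ▸ l.2)
      simp [Prod.ext_iff, h, Fin.ext_iff, this]

theorem rowDeg_marginals (d : Fin m × Fin n →₀ ℕ) : rowDeg (marginals d) = d.degree := by
  rw [Finsupp.degree_eq_sum, Fintype.sum_prod_type]
  rfl

theorem sum_column_eq_of_marginals_eq {d d' : Fin m × Fin n →₀ ℕ}
    (h : marginals d = marginals d') (j : Fin n) : ∑ i, d (i, j) = ∑ i, d' (i, j) := by
  obtain ⟨p, rfl⟩ : ∃ p, n = p + 1 := ⟨n - 1, by have := j.2; omega⟩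
  have hcol : ∀ j : Fin p, ∑ i, d (i, j.castSucc) = ∑ i, d' (i, j.castSucc) := fun j =>
    congrArg (fun e => e (Sum.inr j)) h
  refine Fin.lastCases ?_ hcol j
  have hdeg : d.degree = d'.degree := by rw [← rowDeg_marginals, h, rowDeg_marginals]
  rw [Finsupp.degree_eq_sum, Finsupp.degree_eq_sum, Fintype.sum_prod_type_right,
    Fintype.sum_prod_type_right, Fin.sum_univ_castSucc, Fin.sum_univ_castSucc,
    Finset.sum_congr rfl fun j _ => hcol j] at hdeg
  exact Nat.add_left_cancel hdeg

theorem colDeg_marginals_single (i : Fin m) (j : Fin n) (c : ℕ) :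
    colDeg (marginals (Finsupp.single (i, j) c)) = if (j : ℕ) < n - 1 then c else 0 := by
  rw [marginals_single, map_add, colDeg_single_inl, zero_add]
  split_ifs <;> simp

theorem colDeg_marginals_le (d : Fin m × Fin n →₀ ℕ) : colDeg (marginals d) ≤ d.degree := by
  induction d using Finsupp.induction_linear with
  | zero => simp
  | add f g hf hg => simp only [map_add]; omega
  | single p c =>
    rw [colDeg_marginals_single, Finsupp.degree_single]
    split_ifs <;> omega

theorem exists_marginals_eq (hn : 0 < n) (e : Fin m ⊕ Fin (n - 1) →₀ ℕ)
    (he : colDeg e ≤ rowDeg e) : ∃ d : Fin m × Fin n →₀ ℕ, marginals d = e := by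
  induction hN : rowDeg e generalizing e with
  | zero =>
    refine ⟨0, ?_⟩
    ext (i | j)
    · have := apply_inl_le_rowDeg e i
      simp; omega
    · have := apply_inr_le_colDeg e j
      simp; omega
  | succ N ih =>
    obtain ⟨i, hi⟩ := exists_inl_pos_of_rowDeg_pos (e := e) (by omega)
    rcases Nat.eq_zero_or_pos (colDeg e) with h0 | h0
    · obtain ⟨e', rfl⟩ := exists_add_of_le
        (Finsupp.single_le_iff.2 hi : Finsupp.single (Sum.inl i) 1 ≤ e)
      simp only [map_add, rowDeg_single_inl, colDeg_single_inl] at he hN h0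
      obtain ⟨d, rfl⟩ := ih e' (by omega) (by omega)
      refine ⟨Finsupp.single (i, ⟨n - 1, by omega⟩) 1 + d, ?_⟩
      rw [map_add, marginals_single, dif_neg (by simp), add_zero]
    · obtain ⟨j, hj⟩ := exists_inr_pos_of_colDeg_pos h0
      obtain ⟨e', rfl⟩ := exists_add_of_le
        (Finsupp.single_le_iff.2 hi : Finsupp.single (Sum.inl i) 1 ≤ e)
      have hj' : 0 < e' (Sum.inr j) := by simpa using hj
      obtain ⟨e', rfl⟩ := exists_add_of_le
        (Finsupp.single_le_iff.2 hj' : Finsupp.single (Sum.inr j) 1 ≤ e')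
      simp only [map_add, rowDeg_single_inl, colDeg_single_inl, rowDeg_single_inr,
        colDeg_single_inr] at he hN
      obtain ⟨d, rfl⟩ := ih e' (by omega) (by omega)
      refine ⟨Finsupp.single (i, ⟨j, j.2.trans_le (Nat.sub_le n 1)⟩) 1 + d, ?_⟩
      rw [map_add, marginals_single, dif_pos j.2, add_assoc]

end Exponents

section DeterminantalMonomials

variable {m n}

/-- The class in `R` of a monomial of `P`. -/
def detMonomial (d : Fin m × Fin n →₀ ℕ) : DetR 𝕜 m n :=
  Ideal.Quotient.mk (detI2 𝕜 m n) (monomial d 1)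

theorem detMonomial_add (d d' : Fin m × Fin n →₀ ℕ) :
    detMonomial 𝕜 (d + d') = detMonomial 𝕜 d * detMonomial 𝕜 d' := by
  rw [detMonomial, detMonomial, detMonomial, ← map_mul, monomial_mul_monomial, one_mul]

theorem detMonomial_single (i : Fin m) (j : Fin n) (c : ℕ) :
    detMonomial 𝕜 (Finsupp.single (i, j) c) = detx 𝕜 m n i j ^ c := by
  rw [detMonomial, detx, ← map_pow, X_pow_eq]

theorem detx_mul_detx (i k : Fin m) (j l : Fin n) :
    detx 𝕜 m n i j * detx 𝕜 m n k l = detx 𝕜 m n i l * detx 𝕜 m n k j := by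
  have key : ∀ (i k : Fin m) (j l : Fin n), i < k → j < l →
      detx 𝕜 m n i j * detx 𝕜 m n k l = detx 𝕜 m n i l * detx 𝕜 m n k j := by
    intro i k j l hik hjl
    simp only [detx, ← map_mul]
    exact Ideal.Quotient.eq.2 (Ideal.subset_span ⟨i, k, j, l, hik, hjl, rfl⟩)
  rcases lt_trichotomy i k with h | rfl | h <;> rcases lt_trichotomy j l with h' | rfl | h'
  · exact key i k j l h h'
  · rfl
  · exact (key i k l j h h').symm
  · exact mul_comm _ _
  · rfl
  · exact mul_comm _ _
  · rw [mul_comm, ← key k i j l h h', mul_comm]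
  · rfl
  · rw [mul_comm, key k i l j h h', mul_comm]

theorem detMonomial_eq_of_marginals_eq (d d' : Fin m × Fin n →₀ ℕ)
    (h : marginals d = marginals d') : detMonomial 𝕜 d = detMonomial 𝕜 d' := by
  induction hN : d.degree generalizing d d' with
  | zero =>
    have h' : d'.degree = 0 := by rw [← rowDeg_marginals, ← h, rowDeg_marginals, hN]
    rw [Finsupp.degree_eq_zero_iff] at hN h'
    rw [hN, h']
  | succ N ih =>
    obtain ⟨⟨i, j⟩, hij⟩ : ∃ p, 0 < d p := by
      by_contra! hd
      have : d = 0 := by ext p; simpa using hd p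
      simp [this] at hN
    obtain ⟨l, hl⟩ : ∃ l, 0 < d' (i, l) := by
      have h1 : 0 < ∑ l, d' (i, l) := by
        rw [← marginals_inl, ← h, marginals_inl]
        exact hij.trans_le (Finset.single_le_sum (f := fun j => d (i, j))
          (fun _ _ => Nat.zero_le _) (Finset.mem_univ j))
      obtain ⟨l, -, hl⟩ := Finset.sum_pos_iff.1 h1
      exact ⟨l, hl⟩
    obtain ⟨k, hk⟩ : ∃ k, 0 < d' (k, j) := by
      have h1 : 0 < ∑ k, d' (k, j) := by
        rw [← sum_column_eq_of_marginals_eq h]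
        exact hij.trans_le (Finset.single_le_sum (f := fun i => d (i, j))
          (fun _ _ => Nat.zero_le _) (Finset.mem_univ i))
      obtain ⟨l, -, hl⟩ := Finset.sum_pos_iff.1 h1
      exact ⟨l, hl⟩
    obtain ⟨r, hr1, hr2⟩ : ∃ r : Fin m × Fin n →₀ ℕ,
        marginals (Finsupp.single (i, j) 1 + r) = marginals d' ∧
        detMonomial 𝕜 (Finsupp.single (i, j) 1 + r) = detMonomial 𝕜 d' := by
      by_cases hd : 0 < d' (i, j)
      · obtain ⟨r, rfl⟩ := exists_add_of_le
          (Finsupp.single_le_iff.2 hd : Finsupp.single (i, j) 1 ≤ d')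
        exact ⟨r, rfl, rfl⟩
      · obtain ⟨r, rfl⟩ := exists_add_of_le
          (Finsupp.single_le_iff.2 hl : Finsupp.single (i, l) 1 ≤ d')
        have hne : (i, l) ≠ (k, j) := by
          rintro ⟨⟩
          exact hd hk
        have hk' : 0 < r (k, j) := by
          simpa [Finsupp.single_apply, hne] using hk
        obtain ⟨r, rfl⟩ := exists_add_of_le
          (Finsupp.single_le_iff.2 hk' : Finsupp.single (k, j) 1 ≤ r)
        refine ⟨Finsupp.single (k, l) 1 + r, ?_, ?_⟩
        · simp only [map_add, marginals_single]
          abel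
        · simp only [detMonomial_add, detMonomial_single, pow_one, ← mul_assoc]
          rw [detx_mul_detx]
    obtain ⟨d, rfl⟩ := exists_add_of_le
      (Finsupp.single_le_iff.2 hij : Finsupp.single (i, j) 1 ≤ d)
    rw [← hr2, detMonomial_add, detMonomial_add, ih d r ?_ ?_]
    · rw [← hr1, map_add, map_add] at h
      exact add_left_cancel h
    · rw [map_add, Finsupp.degree_single] at hN
      omega

theorem detMonomial_mem_pow (d : Fin m × Fin n →₀ ℕ) :
    detMonomial 𝕜 d ∈ detJ 𝕜 m n ^ colDeg (marginals d) := by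
  induction d using Finsupp.induction_linear with
  | zero => simp
  | add f g hf hg =>
    rw [detMonomial_add, map_add, map_add]
    have := pow_add (detJ 𝕜 m n) (colDeg (marginals f)) (colDeg (marginals g))
    rw [this]
    exact Ideal.mul_mem_mul hf hg
  | single p c =>
    obtain ⟨i, j⟩ := p
    rw [detMonomial_single, colDeg_marginals_single]
    split_ifs with h
    · have hx : detx 𝕜 m n i j ∈ detJ 𝕜 m n := Ideal.subset_span ⟨i, j, h, rfl⟩
      exact Ideal.pow_mem_pow hx c
    · simp

end DeterminantalMonomials

section Truncation

theorem mem_of_coeff_eq_zero_of_degree_lt {k σ : Type} [Field k] [Finite σ] (N : ℕ)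
    (K : Ideal (MvPowerSeries σ k)) (hK : ∀ e : σ →₀ ℕ, e.degree = N → monomial e 1 ∈ K)
    (f : MvPowerSeries σ k) (hf : ∀ e, e.degree < N → coeff e f = 0) : f ∈ K := by
  classical
  choose! r hr using fun (d : σ →₀ ℕ) (h : N ≤ d.degree) => Finsupp.exists_le_degree_eq d N h
  let D : Finset (σ →₀ ℕ) := (Finsupp.finite_of_degree_le N).toFinset.filter (·.degree = N)
  have hD : ∀ e, e ∈ D ↔ e.degree = N := fun e => by
    simp only [D, Finset.mem_filter, Set.Finite.mem_toFinset, Set.mem_ofPred_eq]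
    exact ⟨fun h => h.2, fun h => ⟨h.le, h⟩⟩
  let g : (σ →₀ ℕ) → MvPowerSeries σ k := fun e d =>
    if r (e + d) = e then coeff (e + d) f else 0
  have hg : ∀ e d, coeff d (g e) = if r (e + d) = e then coeff (e + d) f else 0 :=
    fun _ _ => rfl
  have hfg : f = ∑ e ∈ D, monomial e 1 * g e := by
    ext d
    rw [map_sum]
    by_cases hd : N ≤ d.degree
    · rw [Finset.sum_eq_single_of_mem (r d) ((hD _).2 (hr d hd).2)]
      · obtain ⟨d', hd'⟩ := exists_add_of_le (hr d hd).1
        rw [coeff_monomial_mul, if_pos (hr d hd).1, hg, add_tsub_cancel_of_le (hr d hd).1,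
          if_pos rfl, one_mul]
      · intro e _ hne
        rw [coeff_monomial_mul]
        split_ifs with hle
        · rw [hg, add_tsub_cancel_of_le hle, if_neg hne.symm, mul_zero]
        · rfl
    · rw [hf d (by omega), Finset.sum_eq_zero]
      intro e he
      rw [coeff_monomial_mul, if_neg]
      intro hle
      have := Finsupp.degree_mono hle
      rw [(hD e).1 he] at this
      exact hd this
  rw [hfg]
  exact Ideal.sum_mem _ fun e he => Ideal.mul_mem_right _ _ (hK e ((hD e).1 he))

end Truncation

section DeterminantalHom

theorem hasSubst_marginals : HasSubst fun p : Fin m × Fin n =>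
    (monomial (marginals (Finsupp.single p 1)) 1 : DetS 𝕜 m n) :=
  hasSubst_of_constantCoeff_zero fun p => by
    classical
    rw [← coeff_zero_eq_constantCoeff_apply, coeff_monomial, if_neg]
    intro h
    have := rowDeg_marginals (Finsupp.single p 1)
    rw [← h, Finsupp.degree_single, map_zero] at this
    omega

/-- The substitution `x_{ij} ↦ a_j x_i` for `j < n` and `x_{in} ↦ x_i`. -/
def detSubst : DetP 𝕜 m n →ₐ[𝕜] DetS 𝕜 m n :=
  substAlgHom (hasSubst_marginals 𝕜 m n)

variable {m n}

theorem prod_monomial_marginals (d : Fin m × Fin n →₀ ℕ) :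
    (d.prod fun p c => (monomial (marginals (Finsupp.single p 1)) (1 : 𝕜)) ^ c) =
      monomial (marginals d) 1 := by
  induction d using Finsupp.induction_linear with
  | zero => simp [monomial_zero_one]
  | add f g hf hg =>
    rw [Finsupp.prod_add_index' (by simp) (by simp [pow_add]), hf, hg, map_add,
      monomial_mul_monomial, one_mul]
  | single p c =>
    rw [Finsupp.prod_single_index (by simp), monomial_pow, one_pow, ← map_nsmul,
      Finsupp.smul_single_one]

theorem detSubst_monomial (d : Fin m × Fin n →₀ ℕ) :
    detSubst 𝕜 m n (monomial d 1) = monomial (marginals d) 1 := by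
  rw [detSubst, substAlgHom_monomial, prod_monomial_marginals, map_one, one_mul]

open scoped Classical in
theorem coeff_detSubst (f : DetP 𝕜 m n) (e : Fin m ⊕ Fin (n - 1) →₀ ℕ)
    (D : Finset (Fin m × Fin n →₀ ℕ)) (hD : ∀ d, marginals d = e → d ∈ D) :
    coeff e (detSubst 𝕜 m n f) = ∑ d ∈ D with marginals d = e, coeff d f := by
  rw [detSubst, coe_substAlgHom, coeff_subst (hasSubst_marginals 𝕜 m n)]
  simp only [prod_monomial_marginals]
  rw [finsum_eq_sum_of_support_subset (s := D)]
  · rw [Finset.sum_filter]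
    refine Finset.sum_congr rfl fun d _ => ?_
    rw [coeff_monomial]
    simp only [eq_comm (a := e)]
    split_ifs <;> simp
  · intro d hd
    refine hD d ?_
    by_contra hne
    exact hd (by simp only; rw [coeff_monomial, if_neg (Ne.symm hne), smul_zero])

theorem detSubst_eq_zero (f : DetP 𝕜 m n) (hf : f ∈ detI2 𝕜 m n) : detSubst 𝕜 m n f = 0 := by
  suffices h : detI2 𝕜 m n ≤ RingHom.ker (detSubst 𝕜 m n) from h hf
  refine Ideal.span_le.2 ?_
  rintro _ ⟨i, k, j, l, -, -, rfl⟩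
  simp only [SetLike.mem_coe, RingHom.mem_ker, X_def, monomial_mul_monomial, map_sub, one_mul,
    detSubst_monomial]
  rw [sub_eq_zero, map_add, map_add]
  simp only [marginals_single]
  congr 2
  abel

variable (m n) in
/-- The homomorphism `R → S` with `x_{ij} ↦ a_j x_i` for `j < n` and `x_{in} ↦ x_i`. -/
def detHom : DetR 𝕜 m n →ₐ[𝕜] DetS 𝕜 m n :=
  Ideal.Quotient.liftₐ (detI2 𝕜 m n) (detSubst 𝕜 m n) (detSubst_eq_zero 𝕜)

instance : Algebra (DetR 𝕜 m n) (DetS 𝕜 m n) := (detHom 𝕜 m n).toRingHom.toAlgebra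

theorem algebraMap_mk (f : DetP 𝕜 m n) : algebraMap (DetR 𝕜 m n) (DetS 𝕜 m n)
    (Ideal.Quotient.mk (detI2 𝕜 m n) f) = detSubst 𝕜 m n f := rfl

instance : IsScalarTower 𝕜 (DetR 𝕜 m n) (DetS 𝕜 m n) :=
  IsScalarTower.of_algebraMap_eq fun c => ((detHom 𝕜 m n).commutes c).symm

theorem algebraMap_detx (i : Fin m) (j : Fin n) (hj : (j : ℕ) = n - 1) :
    algebraMap (DetR 𝕜 m n) (DetS 𝕜 m n) (detx 𝕜 m n i j) = X (Sum.inl i) := by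
  rw [detx, algebraMap_mk, X_def, detSubst_monomial, marginals_single, dif_neg (by omega),
    add_zero, ← X_def]

theorem coeff_detSubst_of_rowDeg_lt (f : DetP 𝕜 m n) (e : Fin m ⊕ Fin (n - 1) →₀ ℕ)
    (he : rowDeg e < colDeg e) : coeff e (detSubst 𝕜 m n f) = 0 := by
  classical
  rw [coeff_detSubst 𝕜 f e ∅, Finset.filter_empty, Finset.sum_empty]
  rintro d rfl
  rw [rowDeg_marginals] at he
  exact absurd (colDeg_marginals_le d) (by omega)

end DeterminantalHom

section ColumnFiltration

variable {m n}

/-- The exponents of `S` of degree at least `t` in the variables `a_j`. -/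
def colUpperSet (t : ℕ) : UpperSet (Fin m ⊕ Fin (n - 1) →₀ ℕ) where
  carrier := {e | t ≤ colDeg e}
  upper' := fun _ _ h ha => le_trans ha (colDeg_mono h)

theorem mem_colUpperSet {t : ℕ} {e : Fin m ⊕ Fin (n - 1) →₀ ℕ} :
    e ∈ colUpperSet t ↔ t ≤ colDeg e := Iff.rfl

variable (m n)

/-- The ideal `(a_1, …, a_{n-1})^t` of `S`. -/
def colFiltration (t : ℕ) : Submodule (DetR 𝕜 m n) (DetS 𝕜 m n) :=
  supportSubmodule 𝕜 (DetR 𝕜 m n) (colUpperSet t)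

variable {m n}

theorem mem_colFiltration {t : ℕ} {f : DetS 𝕜 m n} :
    f ∈ colFiltration 𝕜 m n t ↔ ∀ e, colDeg e < t → coeff e f = 0 := by
  simp only [colFiltration, mem_supportSubmodule, mem_colUpperSet, not_le]

theorem mul_mem_colFiltration {s t : ℕ} {f g : DetS 𝕜 m n} (hf : f ∈ colFiltration 𝕜 m n s)
    (hg : g ∈ colFiltration 𝕜 m n t) : f * g ∈ colFiltration 𝕜 m n (s + t) := by
  classical
  rw [mem_colFiltration] at hf hg ⊢
  intro e he
  rw [coeff_mul]
  refine Finset.sum_eq_zero fun p hp => ?_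
  rw [← Finset.HasAntidiagonal.mem_antidiagonal.1 hp, map_add] at he
  by_cases h : colDeg p.1 < s
  · rw [hf _ h, zero_mul]
  · rw [hg p.2 (by omega), mul_zero]

theorem algebraMap_mem_colFiltration (t : ℕ) (r : DetR 𝕜 m n) (hr : r ∈ detJ 𝕜 m n ^ t) :
    algebraMap (DetR 𝕜 m n) (DetS 𝕜 m n) r ∈ colFiltration 𝕜 m n t := by
  induction t generalizing r with
  | zero => exact (mem_colFiltration 𝕜).2 fun e he => absurd he (by omega)
  | succ t ih =>
    have hpow := pow_succ (detJ 𝕜 m n) t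
    rw [hpow] at hr
    refine Submodule.mul_induction_on hr (fun a ha b hb => ?_) fun a b ha hb => ?_
    · rw [map_mul]
      refine mul_mem_colFiltration 𝕜 (ih a ha) ?_
      refine Submodule.span_induction ?_ ?_ ?_ ?_ hb
      · rintro _ ⟨i, j, hj, rfl⟩
        rw [mem_colFiltration]
        intro e he
        classical
        rw [detx, algebraMap_mk, X_def, detSubst_monomial, coeff_monomial, if_neg]
        rintro rfl
        rw [colDeg_marginals_single, if_pos hj] at he
        omega
      · rw [map_zero]; exact zero_mem _
      · intro x y _ _ hx hy
        rw [map_add]; exact add_mem hx hy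
      · intro a x _ hx
        rw [smul_eq_mul, map_mul, ← Algebra.smul_def]
        exact Submodule.smul_mem _ _ hx
    · rw [map_add]; exact add_mem ha hb

end ColumnFiltration

section Cokernel

variable {m n}

theorem detx_mem_maximalIdeal [IsLocalRing (DetR 𝕜 m n)] (i : Fin m) (j : Fin n) :
    detx 𝕜 m n i j ∈ IsLocalRing.maximalIdeal (DetR 𝕜 m n) := by
  classical
  rw [IsLocalRing.mem_maximalIdeal, mem_nonunits_iff]
  intro h
  have h1 := (h.map (algebraMap (DetR 𝕜 m n) (DetS 𝕜 m n))).map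
    (constantCoeff (σ := Fin m ⊕ Fin (n - 1)) (R := 𝕜))
  rw [detx, algebraMap_mk, X_def, detSubst_monomial, ← coeff_zero_eq_constantCoeff_apply,
    coeff_monomial, if_neg] at h1
  · exact not_isUnit_zero h1
  · intro h0
    have := rowDeg_marginals (Finsupp.single (i, j) 1)
    rw [← h0, Finsupp.degree_single, map_zero] at this
    omega

theorem detMonomial_mem_maximalIdeal_pow [IsLocalRing (DetR 𝕜 m n)]
    (d : Fin m × Fin n →₀ ℕ) :
    detMonomial 𝕜 d ∈ IsLocalRing.maximalIdeal (DetR 𝕜 m n) ^ d.degree := by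
  induction d using Finsupp.induction_linear with
  | zero => simp
  | add f g hf hg =>
    rw [detMonomial_add, map_add, pow_add]
    exact Ideal.mul_mem_mul hf hg
  | single p c =>
    rw [detMonomial_single, Finsupp.degree_single]
    exact Ideal.pow_mem_pow (detx_mem_maximalIdeal 𝕜 p.1 p.2) c

theorem mk_monomial (d : Fin m × Fin n →₀ ℕ) (c : 𝕜) :
    Ideal.Quotient.mk (detI2 𝕜 m n) (monomial d c) = c • detMonomial 𝕜 d := by
  have : (monomial d c : DetP 𝕜 m n) = c • monomial d 1 := by
    rw [← map_smul, smul_eq_mul, mul_one]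
  rw [this]
  rfl

theorem sum_monomial_mem_pow (t : ℕ) (f : DetP 𝕜 m n)
    (hf : ∀ e, colDeg e < t → coeff e (detSubst 𝕜 m n f) = 0) (D : Finset (Fin m × Fin n →₀ ℕ))
    (hD : ∀ d ∈ D, ∀ d', d'.degree = d.degree → d' ∈ D) :
    ∑ d ∈ D, coeff d f • detMonomial 𝕜 d ∈ detJ 𝕜 m n ^ t := by
  classical
  rw [← Finset.sum_fiberwise_of_maps_to (t := D.image marginals) (g := marginals)
    fun d hd => Finset.mem_image_of_mem _ hd]
  refine Ideal.sum_mem _ fun e he => ?_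
  obtain ⟨d₀, hd₀, rfl⟩ := Finset.mem_image.1 he
  rcases Nat.lt_or_ge (colDeg (marginals d₀)) t with hlt | hge
  · rw [Finset.sum_congr rfl fun d hd => by
      rw [detMonomial_eq_of_marginals_eq 𝕜 d d₀ (Finset.mem_filter.1 hd).2],
      ← Finset.sum_smul]
    have h0 := coeff_detSubst 𝕜 f (marginals d₀) D fun d hd => hD d₀ hd₀ d (by
      rw [← rowDeg_marginals, hd, rowDeg_marginals])
    rw [hf _ hlt] at h0
    have h1 : ∑ d ∈ D with marginals d = marginals d₀, coeff d f = 0 := by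
      rw [h0]
    rw [h1, zero_smul]
    exact zero_mem _
  · refine Ideal.sum_mem _ fun d hd => ?_
    have hd' : marginals d = marginals d₀ := (Finset.mem_filter.1 hd).2
    refine Submodule.smul_of_tower_mem _ _ (Ideal.pow_le_pow_right hge ?_)
    rw [← hd']
    exact detMonomial_mem_pow 𝕜 d

theorem algebraMap_mem_colFiltration_iff [IsLocalRing (DetR 𝕜 m n)] (t : ℕ)
    (r : DetR 𝕜 m n) :
    algebraMap (DetR 𝕜 m n) (DetS 𝕜 m n) r ∈ colFiltration 𝕜 m n t ↔ r ∈ detJ 𝕜 m n ^ t := by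
  refine ⟨fun h => ?_, algebraMap_mem_colFiltration 𝕜 t r⟩
  obtain ⟨f, rfl⟩ := Ideal.Quotient.mk_surjective r
  rw [algebraMap_mk, mem_colFiltration] at h
  rw [← Ideal.Quotient.eq_zero_iff_mem]
  refine IsHausdorff.haus' (I := IsLocalRing.maximalIdeal (DetR 𝕜 m n)) _ fun N => ?_
  let D : Finset (Fin m × Fin n →₀ ℕ) := (Finsupp.finite_of_degree_le N).toFinset
  have hD : ∀ d, d ∈ D ↔ d.degree ≤ N := fun d => by simp [D]
  let p : DetP 𝕜 m n := ∑ d ∈ D, monomial d (coeff d f)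
  have h1 : Ideal.Quotient.mk (detI2 𝕜 m n) p ∈ detJ 𝕜 m n ^ t := by
    rw [map_sum]
    simp only [mk_monomial]
    exact sum_monomial_mem_pow 𝕜 t f h D fun d hd d' hd' => by rw [hD] at *; omega
  have h2 : Ideal.Quotient.mk (detI2 𝕜 m n) (f - p) ∈
      IsLocalRing.maximalIdeal (DetR 𝕜 m n) ^ N := by
    refine Ideal.mem_comap.1 (mem_of_coeff_eq_zero_of_degree_lt N _ (fun e he => ?_) _ ?_)
    · rw [Ideal.mem_comap, ← he]
      exact detMonomial_mem_maximalIdeal_pow 𝕜 e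
    · classical
      intro e he
      simp only [p, map_sub, map_sum, coeff_monomial]
      rw [Finset.sum_ite_eq, if_pos ((hD e).2 he.le), sub_self]
  rw [SModEq.zero]
  have h3 : Ideal.Quotient.mk (detJ 𝕜 m n ^ t) (Ideal.Quotient.mk (detI2 𝕜 m n) f) =
      Ideal.Quotient.mk (detI2 𝕜 m n) (f - p) •
        (1 : DetR 𝕜 m n ⧸ detJ 𝕜 m n ^ t) := by
    rw [← sub_add_cancel f p, map_add, map_add, Ideal.Quotient.eq_zero_iff_mem.2 h1, add_zero,
      add_sub_cancel_right]
    exact congrArg _ (mul_one _).symm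
  rw [h3]
  exact Submodule.smul_mem_smul h2 trivial

variable (m n) in
/-- The exponents of `S` of degree at least `t` in the `x_i` or in the `a_j`. -/
def totalUpperSet (t : ℕ) : UpperSet (Fin m ⊕ Fin (n - 1) →₀ ℕ) where
  carrier := {e | t ≤ colDeg e ∨ t ≤ rowDeg e}
  upper' := fun _ _ h ha => ha.imp (fun h1 => le_trans h1 (colDeg_mono h))
    fun h1 => le_trans h1 (rowDeg_mono h)

theorem finite_setOf_degrees_lt (s t : ℕ) :
    {e : Fin m ⊕ Fin (n - 1) →₀ ℕ | colDeg e < s ∧ rowDeg e < t}.Finite := by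
  refine Set.Finite.subset (Finsupp.finite_of_degree_le (s + t)) fun e he => ?_
  have : e.degree = rowDeg e + colDeg e := by
    rw [Finsupp.degree_eq_sum, Fintype.sum_sum_type]
    rfl
  simp only [Set.mem_ofPred_eq] at he ⊢
  omega

variable (m n) in
/-- The inclusion of the image of `R` in `S`. -/
abbrev detLinearMap : DetR 𝕜 m n →ₗ[DetR 𝕜 m n] DetS 𝕜 m n :=
  Algebra.linearMap (DetR 𝕜 m n) (DetS 𝕜 m n)

theorem supportSubmodule_totalUpperSet_le (hn : 0 < n) (t : ℕ) :
    supportSubmodule 𝕜 (DetR 𝕜 m n) (totalUpperSet m n t) ≤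
      LinearMap.range (detLinearMap 𝕜 m n) ⊔ colFiltration 𝕜 m n t := by
  classical
  intro f hf
  choose! r hr using exists_marginals_eq (m := m) hn
  let g : DetP 𝕜 m n := fun d => if d = r (marginals d) then coeff (marginals d) f else 0
  have hg : ∀ d, coeff d g = if d = r (marginals d) then coeff (marginals d) f else 0 :=
    fun _ => rfl
  rw [Submodule.mem_sup]
  refine ⟨_, ⟨Ideal.Quotient.mk _ g, rfl⟩, f - detSubst 𝕜 m n g, ?_, add_sub_cancel _ _⟩
  rw [mem_colFiltration]
  intro e he
  rw [map_sub, sub_eq_zero]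
  rcases Nat.lt_or_ge (rowDeg e) (colDeg e) with hlt | hge
  · rw [coeff_detSubst_of_rowDeg_lt 𝕜 g e hlt]
    refine hf e fun h => ?_
    have h : t ≤ colDeg e ∨ t ≤ rowDeg e := h
    omega
  · rw [coeff_detSubst 𝕜 g e (Finsupp.finite_of_degree_le (rowDeg e)).toFinset,
      Finset.sum_eq_single (r e)]
    · rw [hg, hr e hge, if_pos rfl]
    · intro d hd hne
      have h2 : marginals d = e := (Finset.mem_filter.1 hd).2
      rw [hg, h2, if_neg hne]
    · intro h
      refine absurd ?_ h
      rw [Finset.mem_filter]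
      refine ⟨?_, hr e hge⟩
      rw [Set.Finite.mem_toFinset, Set.mem_ofPred_eq, ← rowDeg_marginals, hr e hge]
    · rintro d rfl
      rw [Set.Finite.mem_toFinset, Set.mem_ofPred_eq, ← rowDeg_marginals]

theorem isFiniteLength_quotient_range_sup (hn : 0 < n) (t : ℕ) :
    IsFiniteLength (DetR 𝕜 m n)
      (DetS 𝕜 m n ⧸ (LinearMap.range (detLinearMap 𝕜 m n) ⊔ colFiltration 𝕜 m n t)) := by
  refine IsFiniteLength.of_surjective
    (isFiniteLength_quotient_supportSubmodule (U := totalUpperSet m n t) ?_)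
    (Submodule.factor_surjective (supportSubmodule_totalUpperSet_le 𝕜 hn t))
  refine (finite_setOf_degrees_lt t t).subset fun e he => ?_
  have he : ¬(t ≤ colDeg e ∨ t ≤ rowDeg e) := he
  simp only [Set.mem_ofPred_eq]
  omega

theorem nontrivial_quotient_range_sup (hn : 2 ≤ n) :
    Nontrivial
      (DetS 𝕜 m n ⧸ (LinearMap.range (detLinearMap 𝕜 m n) ⊔ colFiltration 𝕜 m n 2)) := by
  classical
  let e : Fin m ⊕ Fin (n - 1) →₀ ℕ := Finsupp.single (Sum.inr ⟨0, by omega⟩) 1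
  rw [Submodule.Quotient.nontrivial_iff]
  intro h
  have hX : (monomial e 1 : DetS 𝕜 m n) ∈
      LinearMap.range (detLinearMap 𝕜 m n) ⊔ colFiltration 𝕜 m n 2 := h ▸ Submodule.mem_top
  obtain ⟨_, ⟨r, rfl⟩, g, hg, hsum⟩ := Submodule.mem_sup.1 hX
  obtain ⟨f, rfl⟩ := Ideal.Quotient.mk_surjective r
  have h1 := congrArg (coeff e) hsum
  rw [map_add, (mem_colFiltration 𝕜).1 hg e (by simp [e]), Algebra.linearMap_apply,
    algebraMap_mk, coeff_detSubst_of_rowDeg_lt 𝕜 f e (by simp [e]), coeff_monomial_same,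
    add_zero] at h1
  exact zero_ne_one h1

theorem finite_quotient_colFiltration (hn : 0 < n) (t : ℕ) :
    Module.Finite (DetR 𝕜 m n) (DetS 𝕜 m n ⧸ colFiltration 𝕜 m n t) := by
  have h := (isFiniteLength_iff_isNoetherian_isArtinian.1
    (isFiniteLength_quotient_range_sup 𝕜 (m := m) hn t)).1
  rw [sup_comm] at h
  have h' := isNoetherian_of_linearEquiv
    (Submodule.quotientQuotientEquivQuotientSup (colFiltration 𝕜 m n t)
      (LinearMap.range (detLinearMap 𝕜 m n))).symm
  exact Module.Finite.of_submodule_quotient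
    ((LinearMap.range (detLinearMap 𝕜 m n)).map (colFiltration 𝕜 m n t).mkQ)

end Cokernel

section GradedPieces

variable {m n}

variable (m n) in
/-- The exponents of `S` divisible by some `x_i` with `i < j`, or of degree at least `s` in the
variables of `a`. -/
def chainUpperSet (s j : ℕ) : UpperSet (Fin m ⊕ Fin (n - 1) →₀ ℕ) where
  carrier := {e | s ≤ colDeg e ∨ ∃ i : Fin m, (i : ℕ) < j ∧ 0 < e (Sum.inl i)}
  upper' := fun _ _ h ha => ha.imp (fun h1 => le_trans h1 (colDeg_mono h))
    fun ⟨i, hi, h1⟩ => ⟨i, hi, h1.trans_le (h _)⟩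

theorem mem_chainUpperSet {s j : ℕ} {e : Fin m ⊕ Fin (n - 1) →₀ ℕ} :
    e ∈ chainUpperSet m n s j ↔
      s ≤ colDeg e ∨ ∃ i : Fin m, (i : ℕ) < j ∧ 0 < e (Sum.inl i) := Iff.rfl

variable (m n) in
/-- The ideal generated by `(a_1, …, a_{n-1})^s` and the `x_i` with `i < j`. -/
def chainSubmodule (s j : ℕ) : Submodule (DetR 𝕜 m n) (DetS 𝕜 m n) :=
  supportSubmodule 𝕜 (DetR 𝕜 m n) (chainUpperSet m n s j)

theorem chainSubmodule_zero (s : ℕ) : chainSubmodule 𝕜 m n s 0 = colFiltration 𝕜 m n s := by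
  have : chainUpperSet m n s 0 = colUpperSet s := by
    ext e
    change (e ∈ chainUpperSet m n s 0) ↔ e ∈ colUpperSet s
    simp [mem_chainUpperSet, mem_colUpperSet]
  rw [chainSubmodule, this, colFiltration]

theorem chainSubmodule_le_succ (s j : ℕ) :
    chainSubmodule 𝕜 m n s j ≤ chainSubmodule 𝕜 m n s (j + 1) :=
  supportSubmodule_mono fun _ h => h.imp id fun ⟨i, hi, h1⟩ => ⟨i, hi.trans j.lt_succ_self, h1⟩

theorem isFiniteLength_subquotient_chainSubmodule
    (W : Submodule (DetR 𝕜 m n) (DetS 𝕜 m n)) (s : ℕ) :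
    IsFiniteLength (DetR 𝕜 m n) (Subquotient W (chainSubmodule 𝕜 m n s m)) := by
  refine IsFiniteLength.of_injective (isFiniteLength_quotient_supportSubmodule ?_)
    (Subquotient.inclusion_injective W (chainSubmodule 𝕜 m n s m))
  refine (finite_setOf_degrees_lt s 1).subset fun e he => ?_
  have he : ¬(s ≤ colDeg e ∨ ∃ i : Fin m, (i : ℕ) < m ∧ 0 < e (Sum.inl i)) := he
  push Not at he
  refine ⟨he.1, ?_⟩
  by_contra! h
  obtain ⟨i, hi⟩ := exists_inl_pos_of_rowDeg_pos (e := e) (by omega)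
  have := he.2 i i.2
  omega

theorem colFiltration_zero : colFiltration 𝕜 m n 0 = ⊤ :=
  eq_top_iff.2 fun _ _ => (mem_colFiltration 𝕜).2 fun _ he => absurd he (Nat.not_lt_zero _)

theorem nontrivial_subquotient_chainSubmodule :
    Nontrivial (Subquotient (colFiltration 𝕜 m n 0) (chainSubmodule 𝕜 m n 1 m)) := by
  rw [colFiltration_zero]
  refine Submodule.Quotient.nontrivial_iff.2 fun h => ?_
  have h1 : (⟨1, trivial⟩ : (⊤ : Submodule (DetR 𝕜 m n) (DetS 𝕜 m n))) ∈
    (chainSubmodule 𝕜 m n 1 m).submoduleOf ⊤ := h ▸ trivial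
  have h2 : (1 : DetS 𝕜 m n) ∈ chainSubmodule 𝕜 m n 1 m := h1
  have h3 := h2 0 (by simp [mem_chainUpperSet])
  rw [coeff_zero_eq_constantCoeff_apply, map_one] at h3
  exact one_ne_zero h3

variable [IsLocalRing (DetR 𝕜 m n)] {ω : ModuleCat.{0} (DetR 𝕜 m n)}
  [Module.Finite (DetR 𝕜 m n) ω]

theorem extConcentrated_subquotient_colFiltration (hm : 0 < m) (hn : 0 < n)
    (h0 : ExtConcentrated (IsLocalRing.ResidueField (DetR 𝕜 m n)) ω (n - 1 + m))
    (h1 : ¬ ExtVanishes (IsLocalRing.ResidueField (DetR 𝕜 m n)) ω (n - 1 + m)) (t s : ℕ) :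
    ExtConcentrated (Subquotient (colFiltration 𝕜 m n t) (colFiltration 𝕜 m n s)) ω (n - 1) ∧
      (Nontrivial (Subquotient (colFiltration 𝕜 m n t) (chainSubmodule 𝕜 m n s m)) →
        ¬ ExtVanishes (Subquotient (colFiltration 𝕜 m n t) (colFiltration 𝕜 m n s)) ω
          (n - 1)) := by
  let x : ℕ → DetR 𝕜 m n := fun j =>
    if h : j < m then detx 𝕜 m n ⟨j, h⟩ ⟨n - 1, by omega⟩ else 0
  have hx : ∀ j, x j ∈ IsLocalRing.maximalIdeal (DetR 𝕜 m n) := fun j => by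
    by_cases h : j < m
    · simpa only [x, dif_pos h] using detx_mem_maximalIdeal 𝕜 _ _
    · simpa only [x, dif_neg h] using zero_mem _
  have hxX : ∀ j (h : j < m),
      algebraMap (DetR 𝕜 m n) (DetS 𝕜 m n) (x j) = X (Sum.inl ⟨j, h⟩) := fun j h => by
    simp only [x, dif_pos h]
    exact algebraMap_detx 𝕜 _ _ rfl
  have hfin : Module.Finite (DetR 𝕜 m n)
      (Subquotient (colFiltration 𝕜 m n t) (chainSubmodule 𝕜 m n s 0)) := by
    rw [chainSubmodule_zero]
    have := finite_quotient_colFiltration 𝕜 (m := m) hn s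
    exact Module.Finite.of_injective _ (Subquotient.inclusion_injective _ _)
  obtain ⟨p, hp⟩ : ∃ p, n - 1 + m = p + 1 := ⟨n - 1 + m - 1, by omega⟩
  have hlen : ∀ M : Type, ∀ [AddCommGroup M] [Module (DetR 𝕜 m n) M],
      IsFiniteLength (DetR 𝕜 m n) M → ExtConcentrated M ω (n - 1 + m) ∧
        (Nontrivial M → ¬ ExtVanishes M ω (n - 1 + m)) := by
    rw [hp] at h0 h1 ⊢
    exact fun M _ _ hM => isFiniteLength_ext h0 h1 hM
  obtain ⟨h2, h3⟩ := hlen _ (isFiniteLength_subquotient_chainSubmodule 𝕜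
    (colFiltration 𝕜 m n t) s)
  have key := ExtConcentrated.of_chain m (n - 1)
    (fun j => Subquotient (colFiltration 𝕜 m n t) (chainSubmodule 𝕜 m n s j)) x hx
    (fun j => Subquotient.factor _ (chainSubmodule_le_succ 𝕜 s j))
    (fun j hj => Subquotient.smul_injective
      (mem_supportSubmodule_of_smul_mem (hxX j hj) fun e he => ?_))
    (fun j _ => Subquotient.factor_surjective _ _)
    (fun j hj => Subquotient.smul_exact (chainSubmodule_le_succ 𝕜 s j)
      (exists_smul_sub_mem_supportSubmodule (hxX j hj) (fun e he => ?_) fun e he => ?_)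
      (smul_mem_supportSubmodule (hxX j hj) fun e he => ?_)) h2
  · rw [chainSubmodule_zero] at key
    exact ⟨key.1, fun h => key.2 (h3 h)⟩
  · rw [mem_chainUpperSet, map_add, colDeg_single_inl, add_zero] at he
    rw [mem_chainUpperSet]
    refine he.imp id fun ⟨i, hi, h⟩ => ⟨i, hi, ?_⟩
    have hne : (⟨j, hj⟩ : Fin m) ≠ i := fun hh => by simp [← hh] at hi
    simpa [Finsupp.single_apply, hne] using h
  · rwa [mem_colUpperSet, map_add, colDeg_single_inl, add_zero] at he
  · rcases he with he | ⟨i, hi, h⟩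
    · exact Or.inl (Or.inl he)
    · rcases Nat.lt_succ_iff_lt_or_eq.1 hi with hi | rfl
      · exact Or.inl (Or.inr ⟨i, hi, h⟩)
      · exact Or.inr h
  · exact Or.inr ⟨⟨j, hj⟩, j.lt_succ_self, he⟩

theorem extConcentrated_quotient_colFiltration (hm : 0 < m) (hn : 0 < n)
    (h0 : ExtConcentrated (IsLocalRing.ResidueField (DetR 𝕜 m n)) ω (n - 1 + m))
    (h1 : ¬ ExtVanishes (IsLocalRing.ResidueField (DetR 𝕜 m n)) ω (n - 1 + m)) :
    (∀ s, ExtConcentrated (DetS 𝕜 m n ⧸ colFiltration 𝕜 m n s) ω (n - 1)) ∧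
      ¬ ExtVanishes (DetS 𝕜 m n ⧸ colFiltration 𝕜 m n 1) ω (n - 1) := by
  have e : ∀ s, Nonempty (Subquotient (colFiltration 𝕜 m n 0) (colFiltration 𝕜 m n s)
      ≃ₗ[DetR 𝕜 m n] DetS 𝕜 m n ⧸ colFiltration 𝕜 m n s) := fun s => by
    rw [colFiltration_zero]
    exact ⟨LinearEquiv.ofBijective _
      ⟨Subquotient.inclusion_injective _ _, Subquotient.inclusion_top_surjective _⟩⟩
  have h := extConcentrated_subquotient_colFiltration 𝕜 hm hn h0 h1 0
  exact ⟨fun s => (h s).1.congr (e s).some, fun hv =>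
    (h 1).2 (nontrivial_subquotient_chainSubmodule 𝕜) (hv.congr (e 1).some.symm)⟩

end GradedPieces

/-- for any canonical module `ω_R` of `R`, `H^i_I(ω_R) = 0` for all
`i ∉ {n-1, m+n-2}`, while `H^{n-1}_I(ω_R) ≠ 0` and `H^{m+n-2}_I(ω_R) ≠ 0` (so the
cohomological dimension of `I` is `m+n-2`). -/
theorem statement7 [IsLocalRing (DetR 𝕜 m n)] (hm : 2 ≤ m) (hn : 2 ≤ n)
    (ω : ModuleCat (DetR 𝕜 m n)) (hω : IsCanonicalModule (DetR 𝕜 m n) (m + n - 1) ω) :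
    (∀ i : ℕ, i ≠ n - 1 → i ≠ m + n - 2 →
      Subsingleton ((localCohomology (detJ 𝕜 m n) i).obj ω)) ∧
    ¬ Subsingleton ((localCohomology (detJ 𝕜 m n) (n - 1)).obj ω) ∧
    ¬ Subsingleton ((localCohomology (detJ 𝕜 m n) (m + n - 2)).obj ω) := by
  obtain ⟨hfin, hvan, ⟨e⟩⟩ := hω
  have h0 : ExtConcentrated (IsLocalRing.ResidueField (DetR 𝕜 m n)) ω (m + n - 1) :=
    fun i hi => extVanishes_iff_subsingleton.2 ((subsingleton_ext_iff (A := DetR 𝕜 m n) _ _ i).1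
      (hvan i hi))
  have h1 : ¬ ExtVanishes (IsLocalRing.ResidueField (DetR 𝕜 m n)) ω (m + n - 1) := fun h =>
    not_subsingleton (IsLocalRing.ResidueField (DetR 𝕜 m n))
      (@Equiv.subsingleton _ _ e.symm.toEquiv ((subsingleton_ext_iff (A := DetR 𝕜 m n) _ _ _).2
        (extVanishes_iff_subsingleton.1 h)))
  have hd : m + n - 1 = n - 1 + m := by omega
  have hd' : m + n - 1 = m + n - 2 + 1 := by omega
  obtain ⟨hS, hne⟩ := extConcentrated_quotient_colFiltration 𝕜 (by omega) (by omega)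
    (hd ▸ h0) (hd ▸ h1)
  exact localCohomology_two_degrees (by omega) (by omega) (hd' ▸ h0) (hd' ▸ h1)
    (detLinearMap 𝕜 m n) (colFiltration 𝕜 m n)
    (fun t => supportSubmodule_mono fun _ he => (Nat.le_succ t).trans he)
    (algebraMap_mem_colFiltration_iff 𝕜)
    (isFiniteLength_quotient_range_sup 𝕜 (by omega))
    ⟨2, nontrivial_quotient_range_sup 𝕜 hn⟩ hS
    (fun t => (extConcentrated_subquotient_colFiltration 𝕜 (by omega) (by omega)
      (hd ▸ h0) (hd ▸ h1) t (t + 1)).1) ⟨1, hne⟩
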